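/- As n → ∞, 𝔼(y_{n+1} Π̂(n)) = n/M_n^2 + n/M_n^3 + O(n/M_n^4). -/

import Mathlib

open MeasureTheory Filter Finset Asymptotics
open scoped Classical

/-- `y_m(α) = ∏_{j ∈ α, j < m} (1 - 1/j)` (empty product = 1). -/
noncomputable def hawkinsY (A : Set ℕ) (m : ℕ) : ℝ :=
  ∏ j ∈ Finset.range m, if j ∈ A then 1 - 1 / (j : ℝ) else 1

/-- The σ-algebra generated by the events `{j ∈ α}` for `2 ≤ j < m`. -/
def sieveSigma {Ω : Type*} (α : Ω → Set ℕ) (m : ℕ) : MeasurableSpace Ω :=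
  MeasurableSpace.generateFrom {s | ∃ j : ℕ, 2 ≤ j ∧ j < m ∧ s = {ω | j ∈ α ω}}

/-- Wunderlich's model of the Hawkins random sieve: a probability space `(Ω, μ)` with a
random subset `α` of `{2,3,4,…}` such that `μ(2 ∈ α) = 1` and, for every `m ≥ 2`, the
conditional probability of `{m ∈ α}` given the σ-algebra generated by the events
`{j ∈ α}`, `2 ≤ j < m`, equals `y_m(α)`. -/
structure IsHawkinsSieve {Ω : Type*} [MeasurableSpace Ω] (μ : Measure Ω)
    (α : Ω → Set ℕ) : Prop where
  isProb : IsProbabilityMeasure μ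
  meas : ∀ n : ℕ, MeasurableSet {ω | n ∈ α ω}
  mem_ge_two : ∀ ω, ∀ n ∈ α ω, 2 ≤ n
  two_mem : μ {ω | 2 ∈ α ω} = 1
  condExp_mem : ∀ m : ℕ, 2 ≤ m →
    μ[Set.indicator {ω | m ∈ α ω} (fun _ => (1 : ℝ)) | sieveSigma α m]
      =ᵐ[μ] fun ω => hawkinsY (α ω) m

/-- `M_k = 1 + ∑_{j=1}^{k-2} 1/j` (so `M_2 = 1`). -/
noncomputable def Mharm (k : ℕ) : ℝ := 1 + ∑ j ∈ Finset.Icc 1 (k - 2), 1 / (j : ℝ)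

/-- `Π̂(x; α) = Σ_{m ≤ x, m ∈ α, m+2 ∈ α} (y_m(α) - (1/(m+1))(1 - 1/m) y_m(α)^2)⁻¹`. -/
noncomputable def piHat (A : Set ℕ) (x : ℕ) : ℝ :=
  ∑ m ∈ Finset.range (x + 1),
    if m ∈ A ∧ m + 2 ∈ A then
      (hawkinsY A m - (1 / ((m : ℝ) + 1)) * (1 - 1 / (m : ℝ)) * (hawkinsY A m) ^ 2)⁻¹
    else 0

/-- The indicator of `m ∈ A`. -/
noncomputable def sieveInd (A : Set ℕ) (m : ℕ) : ℝ := if m ∈ A then 1 else 0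

/-- The deviation of `1 / y_m` from its mean `M_m`. -/
noncomputable def sieveDev (A : Set ℕ) (m : ℕ) : ℝ := (hawkinsY A m)⁻¹ - Mharm m

/-- The summand of `piHat` with index `m`. -/
noncomputable def twinTerm (A : Set ℕ) (m : ℕ) : ℝ :=
  sieveInd A m * sieveInd A (m + 2) *
    (hawkinsY A m - (1 / ((m : ℝ) + 1)) * (1 - 1 / (m : ℝ)) * (hawkinsY A m) ^ 2)⁻¹

/-! ### The normalising sequence -/

lemma Mharm_two : Mharm 2 = 1 := by simp [Mharm]

lemma Mharm_succ {m : ℕ} (hm : 2 ≤ m) : Mharm (m + 1) = Mharm m + 1 / ((m : ℝ) - 1) := by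
  obtain ⟨k, rfl⟩ := Nat.exists_eq_add_of_le' hm
  have h1 : k + 2 + 1 - 2 = k + 1 := by omega
  have h2 : k + 2 - 2 = k := by omega
  rw [Mharm, Mharm, h1, h2, Finset.sum_Icc_succ_top (by omega)]
  push_cast
  ring

lemma one_le_cast_sub_one {m : ℕ} (hm : 2 ≤ m) : (1 : ℝ) ≤ (m : ℝ) - 1 := by
  have : (2 : ℝ) ≤ m := by exact_mod_cast hm
  linarith

lemma one_le_Mharm (m : ℕ) : 1 ≤ Mharm m := by
  have : 0 ≤ ∑ j ∈ Finset.Icc 1 (m - 2), 1 / (j : ℝ) :=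
    Finset.sum_nonneg fun j _ => by positivity
  rw [Mharm]
  linarith

lemma Mharm_mono : Monotone Mharm := by
  intro a b hab
  unfold Mharm
  gcongr

lemma Mharm_add_five_pow_four_le {m : ℕ} (hm : 2 ≤ m) :
    (Mharm m + 5) ^ 4 ≤ 1296 * ((m : ℝ) - 1) := by
  induction m, hm using Nat.le_induction with
  | base => rw [Mharm_two]; norm_num
  | succ m hm ih =>
    have hk := one_le_cast_sub_one hm
    have hU := one_le_Mharm m
    rw [Mharm_succ hm]
    push_cast
    generalize Mharm m = M at *
    set k : ℝ := (m : ℝ) - 1 with hkdef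
    have hm' : (m : ℝ) + 1 - 1 = k + 1 := by rw [hkdef]; ring
    rw [hm']
    have hkpos : 0 < k := by linarith
    set U := M + 5 with hUdef
    have hU6 : 6 ≤ U := by linarith
    have hi : 1 / k ≤ 1 := by rw [div_le_one hkpos]; exact hk
    have hi0 : 0 < 1 / k := by positivity
    have e : M + 1 / k + 5 = U + 1 / k := by rw [hUdef]; ring
    rw [e]
    set i := 1 / k with hidef
    have hik : k * i = 1 := by rw [hidef]; field_simp
    have h1 : (U + i) ^ 4 ≤ U ^ 4 + i * (4 * U ^ 3 + 6 * U ^ 2 + 4 * U + 1) := by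
      have : (U + i) ^ 4 = U ^ 4 + i * (4 * U ^ 3 + 6 * U ^ 2 * i + 4 * U * i ^ 2 + i ^ 3) := by
        ring
      rw [this]
      have h2 : i ^ 2 ≤ 1 := pow_le_one₀ hi0.le hi
      have h3 : i ^ 3 ≤ 1 := pow_le_one₀ hi0.le hi
      have : 6 * U ^ 2 * i ≤ 6 * U ^ 2 := by
        have : 0 ≤ 6 * U ^ 2 := by positivity
        nlinarith
      have : 4 * U * i ^ 2 ≤ 4 * U := by nlinarith
      gcongr
    have h2 : 4 * U ^ 3 + 6 * U ^ 2 + 4 * U + 1 ≤ U ^ 4 := by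
      nlinarith [pow_pos (by linarith : 0 < U) 2, pow_pos (by linarith : 0 < U) 3]
    have h3 : i * U ^ 4 ≤ 1296 := by
      calc i * U ^ 4 ≤ i * (1296 * k) := by gcongr
        _ = 1296 * (k * i) := by ring
        _ = 1296 := by rw [hik]; ring
    nlinarith

lemma Mharm_le {m : ℕ} (hm : 2 ≤ m) : Mharm m ≤ (m : ℝ) - 1 := by
  induction m, hm using Nat.le_induction with
  | base => rw [Mharm_two]; norm_num
  | succ m hm ih =>
    have hk := one_le_cast_sub_one hm
    have : 1 / ((m : ℝ) - 1) ≤ 1 := by rw [div_le_one (by linarith)]; exact hk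
    rw [Mharm_succ hm]
    push_cast
    linarith

lemma Mharm_sq_le {m : ℕ} (hm : 2 ≤ m) : Mharm m ^ 2 ≤ 3 * ((m : ℝ) - 1) := by
  induction m, hm using Nat.le_induction with
  | base => rw [Mharm_two]; norm_num
  | succ m hm ih =>
    have hk := one_le_cast_sub_one hm
    have hk0 : 0 < (m : ℝ) - 1 := by linarith
    have hM := Mharm_le hm
    have h1 : 1 / ((m : ℝ) - 1) ≤ 1 := by rw [div_le_one (by linarith)]; exact hk
    have h2 : Mharm m * (1 / ((m : ℝ) - 1)) ≤ 1 := by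
      rw [mul_one_div, div_le_one hk0]; exact hM
    have h0 : 0 ≤ 1 / ((m : ℝ) - 1) := by positivity
    rw [Mharm_succ hm]
    push_cast
    nlinarith

lemma sum_inv_Mharm_cube_le {n : ℕ} (hn : 2 ≤ n) :
    ∑ m ∈ Finset.Icc 2 n, 1 / Mharm m ^ 3 ≤ 864 * (n / Mharm n ^ 3) := by
  have key : ∑ m ∈ Finset.Icc 2 n, 1 / (Mharm m + 5) ^ 3
      ≤ 4 * (((n : ℝ) - 1) / (Mharm n + 5) ^ 3) := by
    induction n, hn using Nat.le_induction with
    | base => simp [Mharm_two]; norm_num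
    | succ m hm ih =>
      rw [Finset.sum_Icc_succ_top (by omega)]
      have hk := one_le_cast_sub_one hm
      have hU := one_le_Mharm m
      rw [Mharm_succ hm]
      push_cast
      generalize Mharm m = M at *
      have hm' : (m : ℝ) + 1 - 1 = ((m : ℝ) - 1) + 1 := by ring
      rw [hm']
      generalize (m : ℝ) - 1 = k at *
      have hkpos : 0 < k := by linarith
      have e : M + 1 / k + 5 = (M + 5) + 1 / k := by ring
      rw [e]
      have hU6 : 6 ≤ M + 5 := by linarith
      generalize M + 5 = U at *
      have hi : 1 / k ≤ 1 := by rw [div_le_one hkpos]; exact hk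
      have hi0 : 0 < 1 / k := by positivity
      refine (add_le_add_left ih _).trans ?_
      have hik : k * (1 / k) = 1 := by field_simp
      generalize 1 / k = i at *
      have hU0 : 0 < U := by linarith
      have hUi : 0 < U + i := by linarith
      rw [← sub_nonneg]
      have : 4 * ((k + 1) / (U + i) ^ 3) - (4 * (k / U ^ 3) + 1 / (U + i) ^ 3)
          = ((4 * k + 3) * U ^ 3 - 4 * k * (U + i) ^ 3) / (U ^ 3 * (U + i) ^ 3) := by
        field_simp
        ring
      rw [this]
      apply div_nonneg _ (by positivity)
      have : (4 * k + 3) * U ^ 3 - 4 * k * (U + i) ^ 3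
          = 3 * U ^ 3 - 4 * (k * i) * (3 * U ^ 2 + 3 * U * i + i ^ 2) := by ring
      rw [this, hik]
      have h2 : i ^ 2 ≤ 1 := pow_le_one₀ hi0.le hi
      have h3 : U * i ≤ U := by nlinarith
      nlinarith [pow_pos hU0 2]
  calc ∑ m ∈ Finset.Icc 2 n, 1 / Mharm m ^ 3
      ≤ ∑ m ∈ Finset.Icc 2 n, 216 * (1 / (Mharm m + 5) ^ 3) := by
        refine Finset.sum_le_sum fun m _ => ?_
        have hM := one_le_Mharm m
        have : (Mharm m + 5) ^ 3 ≤ (6 * Mharm m) ^ 3 := by gcongr; linarith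
        rw [mul_one_div, div_le_div_iff₀ (by positivity) (by positivity)]
        linarith
    _ ≤ 216 * (4 * (((n : ℝ) - 1) / (Mharm n + 5) ^ 3)) := by
        rw [← Finset.mul_sum]; gcongr
    _ ≤ 216 * (4 * (n / Mharm n ^ 3)) := by
        have hM := one_le_Mharm n
        gcongr <;> linarith
    _ = 864 * (n / Mharm n ^ 3) := by ring

lemma sum_inv_Mharm_sq_le {n : ℕ} (hn : 2 ≤ n) :
    ∑ m ∈ Finset.Icc 2 n, 1 / Mharm m ^ 2 ≤ 864 * (n / Mharm n ^ 2) := by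
  have hMn := one_le_Mharm n
  calc ∑ m ∈ Finset.Icc 2 n, 1 / Mharm m ^ 2
      ≤ ∑ m ∈ Finset.Icc 2 n, Mharm n * (1 / Mharm m ^ 3) := by
        refine Finset.sum_le_sum fun m hm => ?_
        have hM := one_le_Mharm m
        have := Mharm_mono (Finset.mem_Icc.mp hm).2
        rw [mul_one_div, div_le_div_iff₀ (by positivity) (by positivity)]
        calc 1 * Mharm m ^ 3 = Mharm m * Mharm m ^ 2 := by ring
          _ ≤ Mharm n * Mharm m ^ 2 := by gcongr
    _ ≤ Mharm n * (864 * (n / Mharm n ^ 3)) := by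
        rw [← Finset.mul_sum]
        gcongr
        exact sum_inv_Mharm_cube_le hn
    _ = 864 * (n / Mharm n ^ 2) := by field_simp

lemma abs_sum_inv_Mharm_sub_le {n : ℕ} (hn : 2 ≤ n) :
    |∑ m ∈ Finset.Icc 2 n, 1 / Mharm m
      - (((n : ℝ) - 1) / Mharm n + ((n : ℝ) - 1) / Mharm n ^ 2)|
      ≤ 8 * ∑ m ∈ Finset.Icc 2 n, 1 / Mharm m ^ 3 := by
  induction n, hn using Nat.le_induction with
  | base => simp [Mharm_two]; norm_num
  | succ m hm ih =>
    rw [Finset.sum_Icc_succ_top (by omega), Finset.sum_Icc_succ_top (by omega), mul_add]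
    have hk := one_le_cast_sub_one hm
    have hM := one_le_Mharm m
    rw [Mharm_succ hm]
    push_cast
    have hm' : (m : ℝ) + 1 - 1 = ((m : ℝ) - 1) + 1 := by ring
    rw [hm']
    generalize Mharm m = M at *
    generalize (m : ℝ) - 1 = k at *
    have hkpos : 0 < k := by linarith
    have hi : 1 / k ≤ 1 := by rw [div_le_one hkpos]; exact hk
    have hi0 : 0 < 1 / k := by positivity
    have hik : k * (1 / k) = 1 := by field_simp
    generalize 1 / k = i at *
    have hMi : 0 < M + i := by linarith
    have hM0 : 0 < M := by linarith
    have step : 1 / (M + i) - (((k + 1) / (M + i) + (k + 1) / (M + i) ^ 2) - (k / M + k / M ^ 2))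
        = (M * i + 2 * M + i) / (M ^ 2 * (M + i) ^ 2) := by
      have : i = k * i * i := by rw [hik]; ring
      field_simp
      linear_combination (i + 2 * M + M ^ 2 + M * i) * hik
    have h0 : 0 ≤ (M * i + 2 * M + i) / (M ^ 2 * (M + i) ^ 2) := by positivity
    have h1 : (M * i + 2 * M + i) / (M ^ 2 * (M + i) ^ 2) ≤ 8 * (1 / (M + i) ^ 3) := by
      rw [mul_one_div, div_le_div_iff₀ (by positivity) (by positivity)]
      have a1 : M * i + 2 * M + i ≤ 4 * M := by nlinarith
      have a2 : M + i ≤ 2 * M := by linarith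
      calc (M * i + 2 * M + i) * (M + i) ^ 3 = (M * i + 2 * M + i) * (M + i) * (M + i) ^ 2 := by
            ring
        _ ≤ (4 * M) * (2 * M) * (M + i) ^ 2 := by gcongr
        _ = _ := by ring
    rw [abs_le] at ih ⊢
    constructor <;> linarith [ih.1, ih.2]

/-! ### Pathwise properties -/

lemma sieveInd_eq_zero_or_one (A : Set ℕ) (m : ℕ) : sieveInd A m = 0 ∨ sieveInd A m = 1 := by
  unfold sieveInd
  split_ifs <;> simp

lemma sieveInd_nonneg (A : Set ℕ) (m : ℕ) : 0 ≤ sieveInd A m := by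
  rcases sieveInd_eq_zero_or_one A m with h | h <;> simp [h]

lemma sieveInd_le_one (A : Set ℕ) (m : ℕ) : sieveInd A m ≤ 1 := by
  rcases sieveInd_eq_zero_or_one A m with h | h <;> simp [h]

lemma hawkinsY_succ (A : Set ℕ) (m : ℕ) :
    hawkinsY A (m + 1) = hawkinsY A m * (1 - sieveInd A m / m) := by
  rw [hawkinsY, hawkinsY, Finset.prod_range_succ, sieveInd]
  split_ifs <;> simp

lemma hawkinsY_two {A : Set ℕ} (hA : ∀ n ∈ A, 2 ≤ n) : hawkinsY A 2 = 1 := by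
  have h0 : 0 ∉ A := fun h => by have := hA 0 h; omega
  have h1 : 1 ∉ A := fun h => by have := hA 1 h; omega
  simp [hawkinsY, Finset.prod_range_succ, h0, h1]

lemma hawkinsY_pos {A : Set ℕ} (hA : ∀ n ∈ A, 2 ≤ n) (m : ℕ) : 0 < hawkinsY A m := by
  refine Finset.prod_pos fun j _ => ?_
  split_ifs with h
  · have := one_le_cast_sub_one (hA j h)
    rw [sub_pos, div_lt_one (by linarith)]
    linarith
  · exact one_pos

lemma hawkinsY_antitone {A : Set ℕ} (hA : ∀ n ∈ A, 2 ≤ n) : Antitone (hawkinsY A) := by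
  refine antitone_nat_of_succ_le fun m => ?_
  rw [hawkinsY_succ]
  have h1 := hawkinsY_pos hA m
  have h2 : 0 ≤ sieveInd A m / m := div_nonneg (sieveInd_nonneg A m) (Nat.cast_nonneg m)
  nlinarith

lemma hawkinsY_le_one {A : Set ℕ} (hA : ∀ n ∈ A, 2 ≤ n) {m : ℕ} (hm : 2 ≤ m) :
    hawkinsY A m ≤ 1 :=
  (hawkinsY_antitone hA hm).trans_eq (hawkinsY_two hA)

lemma hawkinsY_inv_succ (A : Set ℕ) {m : ℕ} (hm : 2 ≤ m) :
    (hawkinsY A (m + 1))⁻¹ = (hawkinsY A m)⁻¹ * (1 + sieveInd A m / ((m : ℝ) - 1)) := by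
  have hk := one_le_cast_sub_one hm
  have hk0 : (m : ℝ) - 1 ≠ 0 := by linarith
  have hm0 : (m : ℝ) ≠ 0 := by linarith
  rw [hawkinsY_succ, mul_inv]
  congr 1
  rcases sieveInd_eq_zero_or_one A m with h | h
  · simp [h]
  · rw [h]
    have : (1 : ℝ) - 1 / m = (m - 1) / m := by field_simp
    rw [this]
    field_simp
    ring

lemma one_le_hawkinsY_inv {A : Set ℕ} (hA : ∀ n ∈ A, 2 ≤ n) {m : ℕ} (hm : 2 ≤ m) :
    1 ≤ (hawkinsY A m)⁻¹ :=
  (one_le_inv₀ (hawkinsY_pos hA m)).mpr (hawkinsY_le_one hA hm)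

lemma hawkinsY_inv_le {A : Set ℕ} (hA : ∀ n ∈ A, 2 ≤ n) {m : ℕ} (hm : 2 ≤ m) :
    (hawkinsY A m)⁻¹ ≤ (m : ℝ) - 1 := by
  induction m, hm using Nat.le_induction with
  | base => rw [hawkinsY_two hA]; norm_num
  | succ m hm ih =>
    have hk := one_le_cast_sub_one hm
    have hk0 : 0 < (m : ℝ) - 1 := by linarith
    rw [hawkinsY_inv_succ A hm]
    have hR := one_le_hawkinsY_inv hA hm
    have h1 : 1 + sieveInd A m / ((m : ℝ) - 1) ≤ 1 + 1 / ((m : ℝ) - 1) := by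
      gcongr
      exact sieveInd_le_one A m
    have h0 : 0 ≤ 1 + sieveInd A m / ((m : ℝ) - 1) := by
      have := div_nonneg (sieveInd_nonneg A m) hk0.le
      linarith
    calc _ ≤ ((m : ℝ) - 1) * (1 + 1 / ((m : ℝ) - 1)) := by gcongr
      _ = _ := by push_cast; field_simp; ring

lemma sieveDev_two {A : Set ℕ} (hA : ∀ n ∈ A, 2 ≤ n) : sieveDev A 2 = 0 := by
  rw [sieveDev, hawkinsY_two hA, Mharm_two]; norm_num

lemma sieveDev_succ (A : Set ℕ) {m : ℕ} (hm : 2 ≤ m) :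
    sieveDev A (m + 1) =
      sieveDev A m + ((hawkinsY A m)⁻¹ * sieveInd A m - 1) / ((m : ℝ) - 1) := by
  rw [sieveDev, sieveDev, hawkinsY_inv_succ A hm, Mharm_succ hm]
  ring

lemma abs_sieveDev_add_three_sub_le {A : Set ℕ} (hA : ∀ n ∈ A, 2 ≤ n) {m : ℕ} (hm : 2 ≤ m) :
    |sieveDev A (m + 3) - sieveDev A m| ≤ 3 * ((hawkinsY A m)⁻¹ / ((m : ℝ) - 1)) := by
  have hk := one_le_cast_sub_one hm
  have hk0 : 0 < (m : ℝ) - 1 := by linarith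
  have hR := one_le_hawkinsY_inv hA hm
  have step : ∀ j : ℕ, 2 ≤ j → (hawkinsY A (j + 1))⁻¹ * ((j : ℝ) - 1) ≤ (hawkinsY A j)⁻¹ * j := by
    intro j hj
    have hj1 := one_le_cast_sub_one hj
    have hRj := one_le_hawkinsY_inv hA hj
    have hi := sieveInd_le_one A j
    rw [hawkinsY_inv_succ A hj]
    have : (hawkinsY A j)⁻¹ * (1 + sieveInd A j / ((j : ℝ) - 1)) * ((j : ℝ) - 1)
        = (hawkinsY A j)⁻¹ * ((j : ℝ) - 1 + sieveInd A j) := by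
      field_simp
    rw [this]
    gcongr
    linarith
  have s1 := step m hm
  have s2 := step (m + 1) (by omega)
  have s3 := step (m + 2) (by omega)
  have hmono : (hawkinsY A m)⁻¹ ≤ (hawkinsY A (m + 3))⁻¹ :=
    inv_anti₀ (hawkinsY_pos hA _) (hawkinsY_antitone hA (by omega))
  have hM1 := Mharm_mono (show m ≤ m + 3 by omega)
  have hM2 : Mharm (m + 3) ≤ Mharm m + 3 / ((m : ℝ) - 1) := by
    rw [Mharm_succ (by omega : 2 ≤ m + 2), Mharm_succ (by omega : 2 ≤ m + 1), Mharm_succ hm]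
    push_cast
    have e1 : 1 / ((m : ℝ) + 1 - 1) ≤ 1 / ((m : ℝ) - 1) := by
      apply one_div_le_one_div_of_le hk0; linarith
    have e2 : 1 / ((m : ℝ) + 2 - 1) ≤ 1 / ((m : ℝ) - 1) := by
      apply one_div_le_one_div_of_le hk0; linarith
    have e3 : 3 / ((m : ℝ) - 1) = 3 * (1 / ((m : ℝ) - 1)) := by ring
    linarith
  have hup : (hawkinsY A (m + 3))⁻¹
      ≤ (hawkinsY A m)⁻¹ + 3 * ((hawkinsY A m)⁻¹ / ((m : ℝ) - 1)) := by
    push_cast at s2 s3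
    have e : (hawkinsY A m)⁻¹ + 3 * ((hawkinsY A m)⁻¹ / ((m : ℝ) - 1))
        = (hawkinsY A m)⁻¹ * ((m : ℝ) + 2) / ((m : ℝ) - 1) := by field_simp; ring
    rw [e, le_div_iff₀ hk0]
    generalize (hawkinsY A (m + 3))⁻¹ = R3 at *
    generalize (hawkinsY A (m + 2))⁻¹ = R2 at *
    generalize (hawkinsY A (m + 1))⁻¹ = R1 at *
    generalize (hawkinsY A m)⁻¹ = R0 at *
    have hm0 : (0 : ℝ) < m := by linarith
    have t1 : R3 * ((m : ℝ) + 1) * m ≤ R2 * (m + 2) * m := by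
      have : R3 * ((m : ℝ) + 1) ≤ R2 * (m + 2) := by linarith
      gcongr
    have t2 : R2 * (m : ℝ) ≤ R1 * (m + 1) := by linarith
    have t3 : R3 * (m : ℝ) * (m + 1) ≤ R1 * (m + 2) * (m + 1) := by nlinarith
    have t4 : R3 * (m : ℝ) ≤ R1 * (m + 2) := le_of_mul_le_mul_right t3 (by linarith)
    have t5 : R3 * ((m : ℝ) - 1) * m ≤ R0 * (m + 2) * m := by nlinarith
    exact le_of_mul_le_mul_right t5 hm0
  have hd : 3 / ((m : ℝ) - 1) ≤ 3 * ((hawkinsY A m)⁻¹ / ((m : ℝ) - 1)) := by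
    rw [← mul_div_assoc]
    gcongr
    linarith
  unfold sieveDev
  rw [abs_le]
  constructor <;> linarith

lemma sieveDev_add_three_sq_le {A : Set ℕ} (hA : ∀ n ∈ A, 2 ≤ n) {m : ℕ} (hm : 2 ≤ m) :
    1 + sieveDev A (m + 3) ^ 2 ≤ 19 * (1 + sieveDev A m ^ 2) := by
  have h1 := abs_sieveDev_add_three_sub_le hA hm
  have hk := one_le_cast_sub_one hm
  have h2 : (hawkinsY A m)⁻¹ / ((m : ℝ) - 1) ≤ 1 := by
    rw [div_le_one (by linarith)]
    exact hawkinsY_inv_le hA hm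
  have h3 : |sieveDev A (m + 3) - sieveDev A m| ≤ 3 := by linarith
  have h4 : (sieveDev A (m + 3) - sieveDev A m) ^ 2 ≤ 3 ^ 2 :=
    sq_le_sq' (abs_le.mp h3).1 (abs_le.mp h3).2
  nlinarith [sq_nonneg (sieveDev A (m + 3) - 2 * sieveDev A m)]

lemma hawkinsY_mul_Mharm {A : Set ℕ} (hA : ∀ n ∈ A, 2 ≤ n) (m : ℕ) :
    hawkinsY A m * Mharm m = 1 - sieveDev A m * hawkinsY A m := by
  have := hawkinsY_pos hA m
  unfold sieveDev
  field_simp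
  ring

lemma hawkinsY_expansion {A : Set ℕ} (hA : ∀ n ∈ A, 2 ≤ n) (m : ℕ) :
    hawkinsY A m = 1 / Mharm m - sieveDev A m / Mharm m ^ 2
      + sieveDev A m ^ 2 * hawkinsY A m / Mharm m ^ 2 := by
  have h := hawkinsY_mul_Mharm hA m
  have hM := one_le_Mharm m
  field_simp
  linear_combination (Mharm m - sieveDev A m) * h

lemma sieveDev_sq_mul_hawkinsY_le {A : Set ℕ} (hA : ∀ n ∈ A, 2 ≤ n) {m : ℕ} (hm : 2 ≤ m) :
    sieveDev A m ^ 2 * hawkinsY A m ≤ 2 / Mharm m * (1 + sieveDev A m ^ 4) := by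
  have h := hawkinsY_mul_Mharm hA m
  have hM := one_le_Mharm m
  have hy := hawkinsY_pos hA m
  have hy1 := hawkinsY_le_one hA hm
  rw [div_mul_eq_mul_div, le_div_iff₀ (by linarith)]
  generalize sieveDev A m = l at *
  generalize hawkinsY A m = y at *
  have e : l ^ 2 * y * Mharm m = l ^ 2 - l ^ 3 * y := by linear_combination l ^ 2 * h
  rw [e]
  have h3 : -(l ^ 3 * y) ≤ |l ^ 3| := by
    have : -(l ^ 3 * y) ≤ |l ^ 3 * y| := neg_le_abs _
    rw [abs_mul, abs_of_pos hy] at this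
    nlinarith [abs_nonneg (l ^ 3)]
  have h4 : |l ^ 3| ≤ 1 + l ^ 4 := by
    rw [abs_le]
    constructor <;> nlinarith [sq_nonneg (l ^ 2 - 1), sq_nonneg (l ^ 2 - l), sq_nonneg (l ^ 2 + l),
      sq_nonneg (l - 1), sq_nonneg (l + 1), sq_nonneg l]
  nlinarith [sq_nonneg (l ^ 2 - 1)]

lemma hawkinsY_sq_mul_le {A : Set ℕ} (hA : ∀ n ∈ A, 2 ≤ n) {m : ℕ} (hm : 2 ≤ m) :
    hawkinsY A m ^ 2 * (1 + sieveDev A m ^ 2) ≤ 4 / Mharm m ^ 2 * (1 + sieveDev A m ^ 4) := by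
  have h := hawkinsY_mul_Mharm hA m
  have hM := one_le_Mharm m
  have hy := hawkinsY_pos hA m
  have hy1 := hawkinsY_le_one hA hm
  rw [div_mul_eq_mul_div, le_div_iff₀ (by positivity)]
  generalize sieveDev A m = l at *
  generalize hawkinsY A m = y at *
  have e : y ^ 2 * (1 + l ^ 2) * Mharm m ^ 2 = (1 - l * y) ^ 2 * (1 + l ^ 2) := by
    rw [← h]; ring
  rw [e]
  have h1 : (1 - l * y) ^ 2 ≤ 2 + 2 * l ^ 2 := by
    have : (l * y) ^ 2 ≤ l ^ 2 := by
      rw [mul_pow]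
      have : y ^ 2 ≤ 1 := pow_le_one₀ hy.le hy1
      nlinarith [sq_nonneg l]
    nlinarith [sq_nonneg (1 + l * y)]
  calc (1 - l * y) ^ 2 * (1 + l ^ 2) ≤ (2 + 2 * l ^ 2) * (1 + l ^ 2) := by gcongr
    _ ≤ _ := by nlinarith [sq_nonneg (l ^ 2 - 1)]

lemma twinTerm_denom_ge {A : Set ℕ} (hA : ∀ n ∈ A, 2 ≤ n) {m : ℕ} (hm : 2 ≤ m) :
    hawkinsY A m / 2 ≤
      hawkinsY A m - (1 / ((m : ℝ) + 1)) * (1 - 1 / (m : ℝ)) * (hawkinsY A m) ^ 2 := by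
  have hy := hawkinsY_pos hA m
  have hy1 := hawkinsY_le_one hA hm
  have hk := one_le_cast_sub_one hm
  have h1 : 1 / ((m : ℝ) + 1) ≤ 1 / 2 := by
    apply one_div_le_one_div_of_le <;> linarith
  have h2 : 1 - 1 / (m : ℝ) ≤ 1 := by
    have : 0 ≤ 1 / (m : ℝ) := by positivity
    linarith
  have h2' : 0 ≤ 1 - 1 / (m : ℝ) := by
    rw [sub_nonneg, div_le_one (by linarith)]; linarith
  have h3 : (1 / ((m : ℝ) + 1)) * (1 - 1 / (m : ℝ)) ≤ 1 / 2 * 1 := by gcongr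
  have h4 : hawkinsY A m ^ 2 ≤ hawkinsY A m := by nlinarith
  have h5 : (1 / ((m : ℝ) + 1)) * (1 - 1 / (m : ℝ)) * (hawkinsY A m) ^ 2
      ≤ (1 / 2 * 1) * hawkinsY A m := by gcongr
  linarith

lemma twinTerm_nonneg {A : Set ℕ} (hA : ∀ n ∈ A, 2 ≤ n) {m : ℕ} (hm : 2 ≤ m) :
    0 ≤ twinTerm A m := by
  have := twinTerm_denom_ge hA hm
  have hy := hawkinsY_pos hA m
  exact mul_nonneg (mul_nonneg (sieveInd_nonneg _ _) (sieveInd_nonneg _ _))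
    (inv_nonneg.mpr (by linarith))

lemma hawkinsY_mul_twinTerm_le {A : Set ℕ} (hA : ∀ n ∈ A, 2 ≤ n) {m : ℕ} (hm : 2 ≤ m) :
    hawkinsY A m * twinTerm A m ≤ 2 * (sieveInd A m * sieveInd A (m + 2)) := by
  have h := twinTerm_denom_ge hA hm
  have hy := hawkinsY_pos hA m
  unfold twinTerm
  set d := hawkinsY A m - (1 / ((m : ℝ) + 1)) * (1 - 1 / (m : ℝ)) * (hawkinsY A m) ^ 2
  have hd : 0 < d := by linarith
  have h1 : hawkinsY A m * d⁻¹ ≤ 2 := by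
    rw [← div_eq_mul_inv, div_le_iff₀ hd]; linarith
  have h0 := mul_nonneg (sieveInd_nonneg A m) (sieveInd_nonneg A (m + 2))
  calc _ = (sieveInd A m * sieveInd A (m + 2)) * (hawkinsY A m * d⁻¹) := by ring
    _ ≤ (sieveInd A m * sieveInd A (m + 2)) * 2 := by gcongr
    _ = _ := by ring

lemma hawkinsY_mul_twinTerm_le_two {A : Set ℕ} (hA : ∀ n ∈ A, 2 ≤ n) {m : ℕ} (hm : 2 ≤ m) :
    hawkinsY A m * twinTerm A m ≤ 2 := by
  have h1 := sieveInd_le_one A m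
  have h2 := sieveInd_le_one A (m + 2)
  have h3 := sieveInd_nonneg A m
  have h4 := sieveInd_nonneg A (m + 2)
  nlinarith [hawkinsY_mul_twinTerm_le hA hm]

lemma piHat_eq_sum_twinTerm {A : Set ℕ} (hA : ∀ n ∈ A, 2 ≤ n) (n : ℕ) :
    piHat A n = ∑ m ∈ Finset.Icc 2 n, twinTerm A m := by
  have h : ∀ m, (if m ∈ A ∧ m + 2 ∈ A then
      (hawkinsY A m - (1 / ((m : ℝ) + 1)) * (1 - 1 / (m : ℝ)) * (hawkinsY A m) ^ 2)⁻¹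
    else 0) = twinTerm A m := by
    intro m
    unfold twinTerm sieveInd
    by_cases h1 : m ∈ A <;> by_cases h2 : m + 2 ∈ A <;> simp [h1, h2]
  unfold piHat
  simp_rw [h]
  symm
  apply Finset.sum_subset
  · intro m hm
    simp only [Finset.mem_Icc, Finset.mem_range] at *
    omega
  · intro m hm hm'
    simp only [Finset.mem_Icc, Finset.mem_range] at *
    have : m ∉ A := fun hmA => hm' ⟨hA m hmA, by omega⟩
    simp [twinTerm, sieveInd, this]

lemma abs_hawkinsY_mul_piHat_sub_le {A : Set ℕ} (hA : ∀ n ∈ A, 2 ≤ n) {n : ℕ} (hn : 5 ≤ n) :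
    |hawkinsY A (n + 1) * piHat A n - hawkinsY A n * ∑ m ∈ Finset.Icc 2 (n - 3), twinTerm A m|
      ≤ 8 := by
  obtain ⟨k, rfl⟩ := Nat.exists_eq_add_of_le' (show 3 ≤ n by omega)
  rw [piHat_eq_sum_twinTerm hA, Finset.sum_Icc_succ_top (by omega),
    Finset.sum_Icc_succ_top (by omega), Finset.sum_Icc_succ_top (by omega), Nat.add_sub_cancel]
  have hS0 : 0 ≤ ∑ m ∈ Finset.Icc 2 k, twinTerm A m :=
    Finset.sum_nonneg fun m hm => twinTerm_nonneg hA (Finset.mem_Icc.mp hm).1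
  have hterm : ∀ m N, 2 ≤ m → m ≤ N → hawkinsY A N * twinTerm A m ≤ 2 := by
    intro m N hm hmN
    refine le_trans ?_ (hawkinsY_mul_twinTerm_le_two hA hm)
    exact mul_le_mul_of_nonneg_right (hawkinsY_antitone hA hmN) (twinTerm_nonneg hA hm)
  have hS : hawkinsY A (k + 3) * ∑ m ∈ Finset.Icc 2 k, twinTerm A m ≤ 2 * k := by
    rw [Finset.mul_sum]
    calc _ ≤ ∑ m ∈ Finset.Icc 2 k, (2 : ℝ) := Finset.sum_le_sum fun m hm => by
            rw [Finset.mem_Icc] at hm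
            exact hterm m _ hm.1 (by omega)
      _ ≤ 2 * k := by
            rw [Finset.sum_const, Nat.card_Icc, nsmul_eq_mul, mul_comm]
            gcongr
            omega
  have hlow : hawkinsY A (k + 3) * (1 - 1 / ((k : ℝ) + 3)) ≤ hawkinsY A (k + 3 + 1) := by
    rw [hawkinsY_succ A (k + 3)]
    have hpos := hawkinsY_pos hA (k + 3)
    have hI := sieveInd_le_one A (k + 3)
    refine mul_le_mul_of_nonneg_left ?_ hpos.le
    have : sieveInd A (k + 3) / ((k + 3 : ℕ) : ℝ) ≤ 1 / ((k : ℝ) + 3) := by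
      push_cast
      gcongr
    linarith
  have hup : hawkinsY A (k + 3 + 1) ≤ hawkinsY A (k + 3) := hawkinsY_antitone hA (by omega)
  have t1 := hterm (k + 1) (k + 3 + 1) (by omega) (by omega)
  have t2 := hterm (k + 2) (k + 3 + 1) (by omega) (by omega)
  have t3 := hterm (k + 3) (k + 3 + 1) (by omega) (by omega)
  have hy := (hawkinsY_pos hA (k + 3 + 1)).le
  have u1 := mul_nonneg hy (twinTerm_nonneg hA (show 2 ≤ k + 1 by omega))
  have u2 := mul_nonneg hy (twinTerm_nonneg hA (show 2 ≤ k + 2 by omega))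
  have u3 := mul_nonneg hy (twinTerm_nonneg hA (show 2 ≤ k + 3 by omega))
  set S := ∑ m ∈ Finset.Icc 2 k, twinTerm A m
  have v1 : hawkinsY A (k + 3 + 1) * S ≤ hawkinsY A (k + 3) * S := by gcongr
  have v2 : hawkinsY A (k + 3) * S - 2 ≤ hawkinsY A (k + 3 + 1) * S := by
    have w1 : hawkinsY A (k + 3) * (1 - 1 / ((k : ℝ) + 3)) * S ≤ hawkinsY A (k + 3 + 1) * S := by
      gcongr
    have w2 : hawkinsY A (k + 3) * S * (1 / ((k : ℝ) + 3)) ≤ 2 := by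
      rw [mul_one_div, div_le_iff₀ (by positivity)]
      linarith
    linarith
  rw [abs_le]
  have e1 : k + 1 + 1 = k + 2 := rfl
  have e2 : k + 2 + 1 = k + 3 := rfl
  simp only [e1, e2]
  constructor <;> linarith

/-! ### Functionals of finitely many coordinates -/

/-- `F` only depends on the elements of its argument below `m`. -/
def DependsBelow (m : ℕ) (F : Set ℕ → ℝ) : Prop :=
  ∀ A B : Set ℕ, (∀ j < m, j ∈ A ↔ j ∈ B) → F A = F B

namespace DependsBelow

variable {m n : ℕ} {F G : Set ℕ → ℝ}

lemma mono (h : DependsBelow m F) (hmn : m ≤ n) : DependsBelow n F :=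
  fun A B hAB => h A B fun j hj => hAB j (hj.trans_le hmn)

lemma const (m : ℕ) (c : ℝ) : DependsBelow m fun _ => c := fun _ _ _ => rfl

lemma comp (f : ℝ → ℝ) (hF : DependsBelow m F) : DependsBelow m fun A => f (F A) :=
  fun A B h => congrArg f (hF A B h)

lemma add (hF : DependsBelow m F) (hG : DependsBelow m G) :
    DependsBelow m fun A => F A + G A :=
  fun A B h => congrArg₂ (· + ·) (hF A B h) (hG A B h)

lemma sub (hF : DependsBelow m F) (hG : DependsBelow m G) :
    DependsBelow m fun A => F A - G A :=
  fun A B h => congrArg₂ (· - ·) (hF A B h) (hG A B h)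

lemma mul (hF : DependsBelow m F) (hG : DependsBelow m G) :
    DependsBelow m fun A => F A * G A :=
  fun A B h => congrArg₂ (· * ·) (hF A B h) (hG A B h)

lemma sum {ι : Type*} {s : Finset ι} {F : ι → Set ℕ → ℝ} (h : ∀ i ∈ s, DependsBelow m (F i)) :
    DependsBelow m fun A => ∑ i ∈ s, F i A :=
  fun A B hAB => Finset.sum_congr rfl fun i hi => h i hi A B hAB

lemma hawkinsY (m : ℕ) : DependsBelow m fun A => hawkinsY A m := by
  intro A B h
  refine Finset.prod_congr rfl fun j hj => ?_
  simp only [h j (Finset.mem_range.mp hj)]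

lemma sieveInd (hmn : m < n) : DependsBelow n fun A => sieveInd A m := by
  intro A B h
  simp only [_root_.sieveInd, h m hmn]

lemma sieveDev (m : ℕ) : DependsBelow m fun A => sieveDev A m :=
  (hawkinsY m).comp fun y => y⁻¹ - Mharm m

lemma twinTerm (m : ℕ) : DependsBelow (m + 3) fun A => twinTerm A m :=
  ((sieveInd (by omega)).mul (sieveInd (by omega))).mul
    (((hawkinsY m).mono (by omega)).comp fun y =>
      (y - (1 / ((m : ℝ) + 1)) * (1 - 1 / (m : ℝ)) * y ^ 2)⁻¹)

lemma exists_factor (h : DependsBelow m F) :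
    ∃ g : Finset ℕ → ℝ, ∀ A : Set ℕ, F A = g ((Finset.range m).filter (· ∈ A)) := by
  refine ⟨fun s => F s, fun A => h _ _ fun j hj => ?_⟩
  simp [hj]

lemma bounded (h : DependsBelow m F) : ∃ C : ℝ, ∀ A, |F A| ≤ C := by
  obtain ⟨g, hg⟩ := h.exists_factor
  refine ⟨∑ s ∈ (Finset.range m).powerset, |g s|, fun A => ?_⟩
  rw [hg]
  exact Finset.single_le_sum (f := fun s => |g s|) (fun _ _ => abs_nonneg _)
    (Finset.mem_powerset.mpr (Finset.filter_subset _ _))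

end DependsBelow

namespace IsHawkinsSieve

variable {Ω : Type*} [MeasurableSpace Ω] {μ : Measure Ω} {α : Ω → Set ℕ}
  {m n : ℕ} {F G W : Set ℕ → ℝ}

lemma sieveSigma_le (h : IsHawkinsSieve μ α) (m : ℕ) : sieveSigma α m ≤ ‹MeasurableSpace Ω› := by
  refine MeasurableSpace.generateFrom_le ?_
  rintro s ⟨j, -, -, rfl⟩
  exact h.meas j

lemma measurable_sieveSigma (h : IsHawkinsSieve μ α) (hF : DependsBelow m F) :
    Measurable[sieveSigma α m] fun ω => F (α ω) := by
  obtain ⟨g, hg⟩ := hF.exists_factor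
  simp_rw [hg]
  have hmem : ∀ j < m, MeasurableSet[sieveSigma α m] {ω | j ∈ α ω} := by
    intro j hj
    by_cases h2 : 2 ≤ j
    · exact MeasurableSpace.measurableSet_generateFrom ⟨j, h2, hj, rfl⟩
    · have : {ω | j ∈ α ω} = ∅ := by
        ext ω
        simp only [Set.mem_ofPred_eq, Set.mem_empty_iff_false, iff_false]
        exact fun hj => h2 (h.mem_ge_two ω j hj)
      rw [this]
      exact @MeasurableSet.empty _ (sieveSigma α m)
  let mF : MeasurableSpace (Finset ℕ) := ⊤
  have hT : @Measurable _ _ (sieveSigma α m) mF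
      fun ω => (Finset.range m).filter (· ∈ α ω) := by
    refine @measurable_to_countable' _ _ mF _ (sieveSigma α m) _ fun s => ?_
    by_cases hs : s ⊆ Finset.range m
    · have : (fun ω => (Finset.range m).filter (· ∈ α ω)) ⁻¹' {s}
          = ⋂ j ∈ Finset.range m, {ω | j ∈ α ω ↔ j ∈ s} := by
        ext ω
        simp only [Set.mem_preimage, Set.mem_singleton_iff, Set.mem_iInter, Set.mem_ofPred_eq,
          Finset.ext_iff, Finset.mem_filter]
        constructor
        · intro hj j hjm
          rw [← hj j]
          tauto
        · intro hj j
          constructor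
          · rintro ⟨a, b⟩
            exact (hj j a).mp b
          · intro a
            exact ⟨hs a, (hj j (hs a)).mpr a⟩
      rw [this]
      refine @Finset.measurableSet_biInter _ _ (sieveSigma α m) _ _ fun j hj => ?_
      have hj' := hmem j (Finset.mem_range.mp hj)
      by_cases hjs : j ∈ s
      · simpa [hjs] using hj'
      · have hc := @MeasurableSet.compl _ _ (sieveSigma α m) hj'
        have : {ω | j ∈ α ω ↔ j ∈ s} = {ω | j ∈ α ω}ᶜ := by
          ext ω
          simp [hjs]
        rwa [this]
    · have : (fun ω => (Finset.range m).filter (· ∈ α ω)) ⁻¹' {s} = ∅ := by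
        ext ω
        simp only [Set.mem_preimage, Set.mem_singleton_iff, Set.mem_empty_iff_false, iff_false]
        rintro rfl
        exact hs (Finset.filter_subset _ _)
      rw [this]
      exact @MeasurableSet.empty _ (sieveSigma α m)
  exact (@measurable_from_top _ _ _ g).comp hT

lemma integrable (h : IsHawkinsSieve μ α) (hF : DependsBelow m F) :
    Integrable (fun ω => F (α ω)) μ := by
  have := h.isProb
  obtain ⟨C, hC⟩ := hF.bounded
  exact Integrable.of_bound
    ((h.measurable_sieveSigma hF).mono (h.sieveSigma_le m) le_rfl).aestronglyMeasurable C
    (Eventually.of_forall fun ω => hC _)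

lemma integral_mul_sieveInd (h : IsHawkinsSieve μ α) (hm : 2 ≤ m) (hW : DependsBelow m W) :
    ∫ ω, W (α ω) * sieveInd (α ω) m ∂μ = ∫ ω, W (α ω) * hawkinsY (α ω) m ∂μ := by
  have := h.isProb
  obtain ⟨C, hC⟩ := hW.bounded
  set g : Ω → ℝ := Set.indicator {ω | m ∈ α ω} (fun _ => (1 : ℝ)) with hg
  have hgI : ∀ ω, g ω = sieveInd (α ω) m := fun ω => by
    simp [hg, sieveInd, Set.indicator_apply]
  have hgi : Integrable g μ := (integrable_const (1 : ℝ)).indicator (h.meas m)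
  have hpull := condExp_stronglyMeasurable_mul_of_bound (μ := μ) (h.sieveSigma_le m)
    (h.measurable_sieveSigma hW).stronglyMeasurable hgi C (Eventually.of_forall fun ω => hC _)
  calc ∫ ω, W (α ω) * sieveInd (α ω) m ∂μ = ∫ ω, ((fun ω => W (α ω)) * g) ω ∂μ := by
        simp [hgI]
    _ = ∫ ω, (μ[(fun ω => W (α ω)) * g | sieveSigma α m]) ω ∂μ :=
        (integral_condExp (h.sieveSigma_le m)).symm
    _ = ∫ ω, W (α ω) * hawkinsY (α ω) m ∂μ := by
        refine integral_congr_ae ?_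
        filter_upwards [hpull, h.condExp_mem m hm] with ω h1 h2
        rw [h1, Pi.mul_apply, h2]

lemma integral_mono (h : IsHawkinsSieve μ α) (hF : DependsBelow m F) (hG : DependsBelow n G)
    (hle : ∀ A : Set ℕ, (∀ j ∈ A, 2 ≤ j) → F A ≤ G A) :
    ∫ ω, F (α ω) ∂μ ≤ ∫ ω, G (α ω) ∂μ :=
  MeasureTheory.integral_mono (h.integrable hF) (h.integrable hG)
    fun ω => hle _ (h.mem_ge_two ω)

lemma integral_congr (h : IsHawkinsSieve μ α)
    (heq : ∀ A : Set ℕ, (∀ j ∈ A, 2 ≤ j) → F A = G A) :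
    ∫ ω, F (α ω) ∂μ = ∫ ω, G (α ω) ∂μ := by
  simp_rw [fun ω => heq (α ω) (h.mem_ge_two ω)]

lemma integral_nonneg (h : IsHawkinsSieve μ α)
    (h0 : ∀ A : Set ℕ, (∀ j ∈ A, 2 ≤ j) → 0 ≤ F A) : 0 ≤ ∫ ω, F (α ω) ∂μ :=
  MeasureTheory.integral_nonneg fun ω => h0 _ (h.mem_ge_two ω)

lemma integral_add (h : IsHawkinsSieve μ α) (hF : DependsBelow m F) (hG : DependsBelow n G) :
    ∫ ω, (F (α ω) + G (α ω)) ∂μ = ∫ ω, F (α ω) ∂μ + ∫ ω, G (α ω) ∂μ :=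
  MeasureTheory.integral_add (h.integrable hF) (h.integrable hG)

lemma integral_sub (h : IsHawkinsSieve μ α) (hF : DependsBelow m F) (hG : DependsBelow n G) :
    ∫ ω, (F (α ω) - G (α ω)) ∂μ = ∫ ω, F (α ω) ∂μ - ∫ ω, G (α ω) ∂μ :=
  MeasureTheory.integral_sub (h.integrable hF) (h.integrable hG)

/-! ### Moments of the deviation -/

lemma integral_mul_sieveDev_succ (h : IsHawkinsSieve μ α) (hm : 2 ≤ m) (hW : DependsBelow m W) :
    ∫ ω, W (α ω) * sieveDev (α ω) (m + 1) ∂μ = ∫ ω, W (α ω) * sieveDev (α ω) m ∂μ := by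
  have hY := DependsBelow.hawkinsY m
  have hV : DependsBelow m fun A => W A * (hawkinsY A m)⁻¹ / ((m : ℝ) - 1) :=
    (hW.mul (hY.comp (·⁻¹))).comp (· / ((m : ℝ) - 1))
  have hI : DependsBelow (m + 1) fun A => sieveInd A m := .sieveInd (by omega)
  have e : ∀ A : Set ℕ, W A * sieveDev A (m + 1) = W A * sieveDev A m
      + (W A * (hawkinsY A m)⁻¹ / ((m : ℝ) - 1) * sieveInd A m - W A / ((m : ℝ) - 1)) := by
    intro A
    rw [sieveDev_succ A hm]
    ring
  simp_rw [e]
  rw [h.integral_add (F := fun A => W A * sieveDev A m) (hW.mul (.sieveDev m))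
    (G := fun A => W A * (hawkinsY A m)⁻¹ / ((m : ℝ) - 1) * sieveInd A m - W A / ((m : ℝ) - 1))
    (((hV.mono (by omega)).mul hI).sub ((hW.comp (· / ((m : ℝ) - 1))).mono (by omega))),
    h.integral_sub (F := fun A => W A * (hawkinsY A m)⁻¹ / ((m : ℝ) - 1) * sieveInd A m)
    (G := fun A => W A / ((m : ℝ) - 1))
    ((hV.mono (by omega)).mul hI) (hW.comp (· / ((m : ℝ) - 1))),
    h.integral_mul_sieveInd hm hV]
  have : ∫ ω, W (α ω) * (hawkinsY (α ω) m)⁻¹ / ((m : ℝ) - 1) * hawkinsY (α ω) m ∂μ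
      = ∫ ω, W (α ω) / ((m : ℝ) - 1) ∂μ :=
    h.integral_congr (F := fun A => W A * (hawkinsY A m)⁻¹ / ((m : ℝ) - 1) * hawkinsY A m)
      (G := fun A => W A / ((m : ℝ) - 1)) fun A hA => by
      have := hawkinsY_pos hA m
      field_simp
  rw [this]
  ring

lemma integral_mul_sieveDev (h : IsHawkinsSieve μ α) (hm : 2 ≤ m) (hW : DependsBelow m W)
    (hmn : m ≤ n) :
    ∫ ω, W (α ω) * sieveDev (α ω) n ∂μ = ∫ ω, W (α ω) * sieveDev (α ω) m ∂μ := by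
  induction n, hmn using Nat.le_induction with
  | base => rfl
  | succ n hmn ih => rw [h.integral_mul_sieveDev_succ (hm.trans hmn) (hW.mono hmn), ih]

/-- If the conditional mean of `φ` grows by a factor at most `1 + C M_m / (m - 1)²` at each step,
then weighted means of `φ` stay bounded up to a constant. -/
lemma integral_mul_comp_sieveDev_le (h : IsHawkinsSieve μ α) {φ : ℝ → ℝ} {C : ℝ} (hC : 0 ≤ C)
    (hφ0 : ∀ l, 0 ≤ φ l)
    (hφ : ∀ l s M R : ℝ, R = M + l → 1 ≤ M → 1 ≤ R → 0 < s → s * R ≤ 1 →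
      R⁻¹ * φ (l + (R - 1) * s) + (1 - R⁻¹) * φ (l - s) ≤ (1 + C * (s ^ 2 * M)) * φ l)
    (hm : 2 ≤ m) (hW : DependsBelow m W) (hW0 : ∀ A : Set ℕ, (∀ j ∈ A, 2 ≤ j) → 0 ≤ W A)
    (hmn : m ≤ n) :
    ∫ ω, W (α ω) * φ (sieveDev (α ω) n) ∂μ
      ≤ Real.exp (4 * C) * ∫ ω, W (α ω) * φ (sieveDev (α ω) m) ∂μ := by
  have step : ∀ j, 2 ≤ j → m ≤ j →
      ∫ ω, W (α ω) * φ (sieveDev (α ω) (j + 1)) ∂μ ≤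
        (1 + C * ((1 / ((j : ℝ) - 1)) ^ 2 * Mharm j)) *
          ∫ ω, W (α ω) * φ (sieveDev (α ω) j) ∂μ := by
    intro j hj hmj
    have hWj := hW.mono hmj
    have hY := DependsBelow.hawkinsY j
    have hI : DependsBelow (j + 1) fun A => sieveInd A j := .sieveInd (by omega)
    have hk := one_le_cast_sub_one hj
    set s := 1 / ((j : ℝ) - 1) with hs
    set a : Set ℕ → ℝ := fun A => W A * φ (sieveDev A j + ((hawkinsY A j)⁻¹ - 1) * s) with ha
    set b : Set ℕ → ℝ := fun A => W A * φ (sieveDev A j - s) with hb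
    have hadep : DependsBelow j a :=
      hWj.mul (((DependsBelow.sieveDev j).add (hY.comp fun y => (y⁻¹ - 1) * s)).comp φ)
    have hbdep : DependsBelow j b := hWj.mul ((DependsBelow.sieveDev j).comp fun l => φ (l - s))
    have habI := (((hadep.sub hbdep).mono (by omega)).mul hI)
    have e : ∀ A : Set ℕ, W A * φ (sieveDev A (j + 1)) = (a A - b A) * sieveInd A j + b A := by
      intro A
      rw [sieveDev_succ A hj, ha, hb]
      rcases sieveInd_eq_zero_or_one A j with hi | hi <;> rw [hi]
      · simp only [hs]
        ring_nf
      · simp only [hs]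
        ring_nf
    simp_rw [e]
    rw [h.integral_add habI (hbdep.mono (Nat.le_succ j)),
      h.integral_mul_sieveInd hj (hadep.sub hbdep),
      ← h.integral_add ((hadep.sub hbdep).mul hY) hbdep, ← integral_const_mul]
    refine h.integral_mono (((hadep.sub hbdep).mul hY).add hbdep)
      (G := fun A => (1 + C * (s ^ 2 * Mharm j)) * (W A * φ (sieveDev A j)))
      ((DependsBelow.const j _).mul (hWj.mul ((DependsBelow.sieveDev j).comp φ))) fun A hA => ?_
    have hs0 : 0 < s := by rw [hs]; positivity
    have hsR : s * (hawkinsY A j)⁻¹ ≤ 1 := by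
      rw [hs, one_div_mul_eq_div, div_le_one (by linarith)]
      exact hawkinsY_inv_le hA hj
    have := hφ (sieveDev A j) s (Mharm j) (hawkinsY A j)⁻¹ (by rw [sieveDev]; ring)
      (one_le_Mharm j) (one_le_hawkinsY_inv hA hj) hs0 hsR
    rw [inv_inv] at this
    calc _ = W A * (hawkinsY A j * φ (sieveDev A j + ((hawkinsY A j)⁻¹ - 1) * s)
          + (1 - hawkinsY A j) * φ (sieveDev A j - s)) := by rw [ha, hb]; ring
      _ ≤ W A * ((1 + C * (s ^ 2 * Mharm j)) * φ (sieveDev A j)) :=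
          mul_le_mul_of_nonneg_left this (hW0 A hA)
      _ = _ := by ring
  have hint0 : ∀ j, 0 ≤ ∫ ω, W (α ω) * φ (sieveDev (α ω) j) ∂μ := fun j =>
    h.integral_nonneg (F := fun A => W A * φ (sieveDev A j))
      fun A hA => mul_nonneg (hW0 A hA) (hφ0 _)
  have key : ∫ ω, W (α ω) * φ (sieveDev (α ω) n) ∂μ ≤
      Real.exp (2 * C * ((Mharm m + 1) / ((m : ℝ) - 1) - (Mharm n + 1) / ((n : ℝ) - 1))) *
        ∫ ω, W (α ω) * φ (sieveDev (α ω) m) ∂μ := by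
    induction n, hmn using Nat.le_induction with
    | base => simp
    | succ j hmj ih =>
      have hj := hm.trans hmj
      have hk := one_le_cast_sub_one hj
      have hM := one_le_Mharm j
      refine (step j hj hmj).trans ?_
      have hpos : 0 ≤ 1 + C * ((1 / ((j : ℝ) - 1)) ^ 2 * Mharm j) := by positivity
      refine (mul_le_mul_of_nonneg_left ih hpos).trans ?_
      rw [← mul_assoc]
      refine mul_le_mul_of_nonneg_right ?_ (hint0 m)
      have hdiff : (1 / ((j : ℝ) - 1)) ^ 2 * Mharm j ≤ 2 * ((Mharm j + 1) / ((j : ℝ) - 1)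
          - (Mharm (j + 1) + 1) / (((j + 1 : ℕ) : ℝ) - 1)) := by
        rw [Mharm_succ hj]
        push_cast
        have hj' : (j : ℝ) + 1 - 1 = ((j : ℝ) - 1) + 1 := by ring
        rw [hj']
        generalize (j : ℝ) - 1 = k at *
        generalize Mharm j = M at *
        have hk0 : 0 < k := by linarith
        have e : 2 * ((M + 1) / k - (M + 1 / k + 1) / (k + 1)) = 2 * M / (k * (k + 1)) := by
          field_simp
          ring
        rw [e, one_div_pow, one_div_mul_eq_div, div_le_div_iff₀ (by positivity) (by positivity)]
        nlinarith [mul_nonneg (by linarith : 0 ≤ M) (mul_nonneg hk0.le (by linarith : 0 ≤ k - 1))]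
      calc _ ≤ Real.exp (C * ((1 / ((j : ℝ) - 1)) ^ 2 * Mharm j)) * _ := by
            refine mul_le_mul_of_nonneg_right ?_ (Real.exp_pos _).le
            rw [add_comm]
            exact Real.add_one_le_exp _
        _ = Real.exp (C * ((1 / ((j : ℝ) - 1)) ^ 2 * Mharm j) + _) := (Real.exp_add _ _).symm
        _ ≤ _ := by
            apply Real.exp_le_exp.mpr
            nlinarith [mul_le_mul_of_nonneg_left hdiff hC]
  refine key.trans (mul_le_mul_of_nonneg_right (Real.exp_le_exp.mpr ?_) (hint0 m))
  have hk := one_le_cast_sub_one hm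
  have hk' := one_le_cast_sub_one (hm.trans hmn)
  have h1 : (Mharm m + 1) / ((m : ℝ) - 1) ≤ 2 := by
    rw [div_le_iff₀ (by linarith)]
    linarith [Mharm_le hm]
  have h2 : 0 ≤ (Mharm n + 1) / ((n : ℝ) - 1) := by
    have := one_le_Mharm n
    positivity
  nlinarith

lemma integral_mul_one_add_sieveDev_sq_le (h : IsHawkinsSieve μ α) (hm : 2 ≤ m)
    (hW : DependsBelow m W) (hW0 : ∀ A : Set ℕ, (∀ j ∈ A, 2 ≤ j) → 0 ≤ W A) (hmn : m ≤ n) :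
    ∫ ω, W (α ω) * (1 + sieveDev (α ω) n ^ 2) ∂μ
      ≤ Real.exp (4 * 2) * ∫ ω, W (α ω) * (1 + sieveDev (α ω) m ^ 2) ∂μ := by
  refine h.integral_mul_comp_sieveDev_le (φ := fun l => 1 + l ^ 2) (by norm_num)
    (fun l => by positivity) ?_ hm hW hW0 hmn
  intro l s M R hR hM hR1 hs hsR
  have hR0 : R ≠ 0 := by linarith
  have e : R⁻¹ * (1 + (l + (R - 1) * s) ^ 2) + (1 - R⁻¹) * (1 + (l - s) ^ 2)
      = 1 + l ^ 2 + s ^ 2 * (R - 1) := by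
    field_simp
    ring
  have hl : R - 1 ≤ 2 * M * (1 + l ^ 2) := by
    have : l ≤ M * (1 + l ^ 2) := by nlinarith [sq_nonneg (l - 1), sq_nonneg l]
    nlinarith [sq_nonneg l]
  simp only [e]
  nlinarith [mul_le_mul_of_nonneg_left hl (sq_nonneg s)]

lemma integral_one_add_sieveDev_pow_four_le (h : IsHawkinsSieve μ α) (hm : 2 ≤ m) :
    ∫ ω, (1 + sieveDev (α ω) m ^ 4) ∂μ ≤ Real.exp (4 * 22) := by
  have := h.isProb
  have key := h.integral_mul_comp_sieveDev_le (φ := fun l => 1 + l ^ 4) (C := 22) (m := 2) (n := m)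
    (W := fun _ => 1) (by norm_num) (fun l => by positivity) ?_ le_rfl (.const _ _)
    (fun _ _ => zero_le_one) hm
  · have h2 : ∫ ω, 1 * (1 + sieveDev (α ω) 2 ^ 4) ∂μ = ∫ ω, (1 : ℝ) ∂μ :=
      h.integral_congr (F := fun A => 1 * (1 + sieveDev A 2 ^ 4)) (G := fun _ => 1)
        fun A hA => by simp [sieveDev_two hA]
    rw [h2] at key
    simpa using key
  · intro l s M R hR hM hR1 hs hsR
    have hR0 : 0 < R := by linarith
    have e : R⁻¹ * (1 + (l + (R - 1) * s) ^ 4) + (1 - R⁻¹) * (1 + (l - s) ^ 4)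
        = 1 + l ^ 4 + s ^ 2 * (6 * l ^ 2 * (R - 1) + 4 * l * (s * ((R - 1) * (R - 2)))
          + s ^ 2 * ((R - 1) * (R ^ 2 - 3 * R + 3))) := by
      field_simp
      ring
    have b1 : 6 * l ^ 2 * (R - 1) ≤ 6 * l ^ 2 * R := by nlinarith [sq_nonneg l]
    have b2 : 4 * l * (s * ((R - 1) * (R - 2))) ≤ 4 * |l| * R := by
      have c1 : |(R - 1) * (R - 2)| ≤ R * R := by
        rw [abs_le]; constructor <;> nlinarith
      have c2 : |s * ((R - 1) * (R - 2))| ≤ R := by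
        rw [abs_mul, abs_of_pos hs]
        nlinarith
      calc 4 * l * (s * ((R - 1) * (R - 2))) ≤ |4 * l * (s * ((R - 1) * (R - 2)))| := le_abs_self _
        _ = 4 * |l| * |s * ((R - 1) * (R - 2))| := by
            rw [abs_mul, abs_mul, abs_of_pos (by norm_num : (0 : ℝ) < 4)]
        _ ≤ _ := by gcongr
    have b3 : s ^ 2 * ((R - 1) * (R ^ 2 - 3 * R + 3)) ≤ R := by
      have c1 : (R - 1) * (R ^ 2 - 3 * R + 3) ≤ R ^ 3 := by nlinarith [sq_nonneg (R - 1)]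
      have c2 : (s * R) ^ 2 ≤ 1 := pow_le_one₀ (by positivity) hsR
      calc s ^ 2 * ((R - 1) * (R ^ 2 - 3 * R + 3)) ≤ s ^ 2 * R ^ 3 := by gcongr
        _ = (s * R) ^ 2 * R := by ring
        _ ≤ 1 * R := by gcongr
        _ = R := one_mul R
    have hRM : R ≤ M * (1 + |l|) := by
      have : l ≤ |l| := le_abs_self l
      nlinarith [abs_nonneg l]
    have hx : (1 + |l|) * (6 * l ^ 2 + 4 * |l| + 1) ≤ 22 * (1 + l ^ 4) := by
      have e2 : l ^ 2 = |l| ^ 2 := (sq_abs l).symm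
      have e4 : l ^ 4 = |l| ^ 4 := by rw [show l ^ 4 = (l ^ 2) ^ 2 by ring, e2]; ring
      rw [e2, e4]
      have hl0 := abs_nonneg l
      generalize |l| = x at *
      nlinarith [sq_nonneg (x ^ 2 - x), sq_nonneg (x ^ 2 - 1), sq_nonneg (x - 1)]
    have htot : 6 * l ^ 2 * (R - 1) + 4 * l * (s * ((R - 1) * (R - 2)))
          + s ^ 2 * ((R - 1) * (R ^ 2 - 3 * R + 3)) ≤ 22 * M * (1 + l ^ 4) := by
      calc _ ≤ R * (6 * l ^ 2 + 4 * |l| + 1) := by linarith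
        _ ≤ M * (1 + |l|) * (6 * l ^ 2 + 4 * |l| + 1) := by gcongr
        _ = M * ((1 + |l|) * (6 * l ^ 2 + 4 * |l| + 1)) := by ring
        _ ≤ M * (22 * (1 + l ^ 4)) := by gcongr
        _ = _ := by ring
    simp only [e]
    nlinarith [mul_le_mul_of_nonneg_left htot (sq_nonneg s)]

lemma integral_sieveDev (h : IsHawkinsSieve μ α) (hm : 2 ≤ m) :
    ∫ ω, sieveDev (α ω) m ∂μ = 0 := by
  have h1 := h.integral_mul_sieveDev (m := 2) (n := m) (W := fun _ => 1) le_rfl (.const _ _) hm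
  have h2 : ∫ ω, 1 * sieveDev (α ω) 2 ∂μ = ∫ ω, (0 : ℝ) ∂μ :=
    h.integral_congr (F := fun A => 1 * sieveDev A 2) (G := fun _ => 0)
      fun A hA => by simp [sieveDev_two hA]
  rw [h2] at h1
  simpa using h1

lemma abs_integral_hawkinsY_sub_le (h : IsHawkinsSieve μ α) (hm : 2 ≤ m) :
    |∫ ω, hawkinsY (α ω) m ∂μ - 1 / Mharm m| ≤ 2 * Real.exp (4 * 22) / Mharm m ^ 3 := by
  have := h.isProb
  have hM := one_le_Mharm m
  have hL := DependsBelow.sieveDev m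
  have hQ : DependsBelow m fun A => sieveDev A m ^ 2 * hawkinsY A m :=
    (hL.comp (· ^ 2)).mul (.hawkinsY m)
  have e : ∫ ω, hawkinsY (α ω) m ∂μ
      = 1 / Mharm m + (∫ ω, sieveDev (α ω) m ^ 2 * hawkinsY (α ω) m ∂μ) / Mharm m ^ 2 := by
    rw [h.integral_congr (F := fun A => hawkinsY A m)
      (G := fun A => (1 / Mharm m - sieveDev A m / Mharm m ^ 2)
        + sieveDev A m ^ 2 * hawkinsY A m / Mharm m ^ 2) fun A hA => hawkinsY_expansion hA m,
      h.integral_add (F := fun A => 1 / Mharm m - sieveDev A m / Mharm m ^ 2)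
        (G := fun A => sieveDev A m ^ 2 * hawkinsY A m / Mharm m ^ 2)
        ((DependsBelow.const m _).sub (hL.comp (· / Mharm m ^ 2))) (hQ.comp (· / Mharm m ^ 2)),
      h.integral_sub (F := fun _ => 1 / Mharm m) (G := fun A => sieveDev A m / Mharm m ^ 2)
        (.const m _) (hL.comp (· / Mharm m ^ 2)),
      integral_div (Mharm m ^ 2), integral_div (Mharm m ^ 2),
      h.integral_sieveDev hm]
    simp
  have h0 : 0 ≤ ∫ ω, sieveDev (α ω) m ^ 2 * hawkinsY (α ω) m ∂μ :=
    h.integral_nonneg (F := fun A => sieveDev A m ^ 2 * hawkinsY A m)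
      fun A hA => mul_nonneg (sq_nonneg _) (hawkinsY_pos hA m).le
  have h1 : ∫ ω, sieveDev (α ω) m ^ 2 * hawkinsY (α ω) m ∂μ
      ≤ 2 / Mharm m * Real.exp (4 * 22) := by
    calc _ ≤ ∫ ω, 2 / Mharm m * (1 + sieveDev (α ω) m ^ 4) ∂μ :=
          h.integral_mono hQ (G := fun A => 2 / Mharm m * (1 + sieveDev A m ^ 4))
            (hL.comp fun l => 2 / Mharm m * (1 + l ^ 4))
            fun A hA => sieveDev_sq_mul_hawkinsY_le hA hm
      _ ≤ _ := by
          rw [integral_const_mul]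
          exact mul_le_mul_of_nonneg_left (h.integral_one_add_sieveDev_pow_four_le hm)
            (by positivity)
  rw [e, add_sub_cancel_left, abs_of_nonneg (by positivity)]
  calc _ ≤ (2 / Mharm m * Real.exp (4 * 22)) / Mharm m ^ 2 := by gcongr
    _ = _ := by field_simp

lemma integral_hawkinsY_sq_mul_le (h : IsHawkinsSieve μ α) (hm : 2 ≤ m) :
    ∫ ω, hawkinsY (α ω) m ^ 2 * (1 + sieveDev (α ω) m ^ 2) ∂μ
      ≤ 4 * Real.exp (4 * 22) / Mharm m ^ 2 := by
  have hM := one_le_Mharm m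
  have hL := DependsBelow.sieveDev m
  calc _ ≤ ∫ ω, 4 / Mharm m ^ 2 * (1 + sieveDev (α ω) m ^ 4) ∂μ :=
        h.integral_mono (F := fun A => hawkinsY A m ^ 2 * (1 + sieveDev A m ^ 2))
          (G := fun A => 4 / Mharm m ^ 2 * (1 + sieveDev A m ^ 4))
          (((DependsBelow.hawkinsY m).comp (· ^ 2)).mul (hL.comp fun l => 1 + l ^ 2))
          (hL.comp fun l => 4 / Mharm m ^ 2 * (1 + l ^ 4))
          fun A hA => hawkinsY_sq_mul_le hA hm
    _ ≤ 4 / Mharm m ^ 2 * Real.exp (4 * 22) := by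
        rw [integral_const_mul]
        exact mul_le_mul_of_nonneg_left (h.integral_one_add_sieveDev_pow_four_le hm)
          (by positivity)
    _ = _ := by ring

/-! ### Twin terms -/

lemma integral_mul_twinTerm (h : IsHawkinsSieve μ α) (hm : 2 ≤ m) (hW : DependsBelow m W) :
    ∫ ω, W (α ω) * twinTerm (α ω) m ∂μ
      = (1 - 1 / (m : ℝ)) * ∫ ω, W (α ω) * hawkinsY (α ω) m ∂μ := by
  have hk := one_le_cast_sub_one hm
  set d : Set ℕ → ℝ := fun A =>
    hawkinsY A m - (1 / ((m : ℝ) + 1)) * (1 - 1 / (m : ℝ)) * (hawkinsY A m) ^ 2 with hd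
  set V : Set ℕ → ℝ := fun A => W A * (d A)⁻¹ * sieveInd A m with hV
  have hVdep : DependsBelow (m + 1) V :=
    ((hW.mul ((DependsBelow.hawkinsY m).comp fun y =>
      (y - (1 / ((m : ℝ) + 1)) * (1 - 1 / (m : ℝ)) * y ^ 2)⁻¹)).mono (by omega)).mul
      (.sieveInd (by omega))
  have hY1 := DependsBelow.hawkinsY (m + 1)
  have hVY : DependsBelow (m + 1) fun A => V A * hawkinsY A (m + 1) := hVdep.mul hY1
  have hVY' : DependsBelow (m + 1) fun A => V A * hawkinsY A (m + 1) / ((m : ℝ) + 1) :=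
    hVY.comp (· / ((m : ℝ) + 1))
  have hI1 : DependsBelow (m + 2) fun A => sieveInd A (m + 1) := .sieveInd (by omega)
  calc ∫ ω, W (α ω) * twinTerm (α ω) m ∂μ = ∫ ω, V (α ω) * sieveInd (α ω) (m + 2) ∂μ := by
        congr 1
        ext ω
        rw [hV, twinTerm]
        ring
    _ = ∫ ω, V (α ω) * hawkinsY (α ω) (m + 2) ∂μ :=
        h.integral_mul_sieveInd (by omega) (hVdep.mono (by omega))
    _ = ∫ ω, (V (α ω) * hawkinsY (α ω) (m + 1)
          - V (α ω) * hawkinsY (α ω) (m + 1) / ((m : ℝ) + 1) * sieveInd (α ω) (m + 1)) ∂μ := by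
        congr 1
        ext ω
        rw [hawkinsY_succ (α ω) (m + 1)]
        push_cast
        ring
    _ = ∫ ω, (V (α ω) * hawkinsY (α ω) (m + 1)
          - V (α ω) * hawkinsY (α ω) (m + 1) / ((m : ℝ) + 1) * hawkinsY (α ω) (m + 1)) ∂μ := by
        rw [h.integral_sub hVY ((hVY'.mono (by omega)).mul hI1),
          h.integral_mul_sieveInd (by omega) hVY', h.integral_sub hVY (hVY'.mul hY1)]
    _ = ∫ ω, (1 - 1 / (m : ℝ)) * (W (α ω) * sieveInd (α ω) m) ∂μ := by
        refine h.integral_congr (F := fun A => V A * hawkinsY A (m + 1)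
          - V A * hawkinsY A (m + 1) / ((m : ℝ) + 1) * hawkinsY A (m + 1))
          (G := fun A => (1 - 1 / (m : ℝ)) * (W A * sieveInd A m)) fun A hA => ?_
        have hdpos : 0 < d A :=
          (half_pos (hawkinsY_pos hA m)).trans_le (twinTerm_denom_ge hA hm)
        rw [hV]
        rcases sieveInd_eq_zero_or_one A m with hi | hi
        · simp [hi]
        · have hy : hawkinsY A (m + 1) = hawkinsY A m * (1 - 1 / m) := by
            rw [hawkinsY_succ, hi]
          simp only [hi, hy]
          have e : d A * (d A)⁻¹ = 1 := mul_inv_cancel₀ hdpos.ne'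
          have hdA : d A
            = hawkinsY A m - (1 / ((m : ℝ) + 1)) * (1 - 1 / (m : ℝ)) * (hawkinsY A m) ^ 2 := rfl
          calc _ = W A * (1 - 1 / (m : ℝ)) * (d A * (d A)⁻¹) := by
                generalize (d A)⁻¹ = z
                rw [hdA]
                ring
            _ = _ := by rw [e]; ring
    _ = _ := by rw [integral_const_mul, h.integral_mul_sieveInd hm hW]

lemma abs_integral_sieveDev_mul_twinTerm_le (h : IsHawkinsSieve μ α) (hm : 2 ≤ m)
    (hmn : m + 3 ≤ n) :
    |∫ ω, sieveDev (α ω) n * twinTerm (α ω) m ∂μ|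
      ≤ (2 * Real.exp (4 * 22) + 9) / Mharm m ^ 2 := by
  have := h.isProb
  have hk := one_le_cast_sub_one hm
  have hk0 : 0 < (m : ℝ) - 1 := by linarith
  have hM := one_le_Mharm m
  have hM2 := Mharm_sq_le hm
  have hX := DependsBelow.twinTerm m
  have hL3 := DependsBelow.sieveDev (m + 3)
  have hL := (DependsBelow.sieveDev m).mono (show m ≤ m + 3 by omega)
  have hY := DependsBelow.hawkinsY m
  have hq0 : 0 ≤ 1 - 1 / (m : ℝ) := by
    rw [sub_nonneg, div_le_one (by linarith)]; linarith
  have hq1 : 1 - 1 / (m : ℝ) ≤ 1 := by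
    have : 0 ≤ 1 / (m : ℝ) := by positivity
    linarith
  have e1 : ∫ ω, sieveDev (α ω) n * twinTerm (α ω) m ∂μ
      = ∫ ω, (sieveDev (α ω) (m + 3) - sieveDev (α ω) m) * twinTerm (α ω) m ∂μ
        + ∫ ω, sieveDev (α ω) m * twinTerm (α ω) m ∂μ := by
    simp_rw [mul_comm (sieveDev (α _) n)]
    rw [h.integral_mul_sieveDev (by omega) hX hmn,
      ← h.integral_add (F := fun A => (sieveDev A (m + 3) - sieveDev A m) * twinTerm A m)
        (G := fun A => sieveDev A m * twinTerm A m) ((hL3.sub hL).mul hX) (hL.mul hX)]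
    congr 1
    ext ω
    ring
  have b1 : |∫ ω, (sieveDev (α ω) (m + 3) - sieveDev (α ω) m) * twinTerm (α ω) m ∂μ|
      ≤ 3 / ((m : ℝ) - 1) := by
    calc _ ≤ ∫ ω, |(sieveDev (α ω) (m + 3) - sieveDev (α ω) m) * twinTerm (α ω) m| ∂μ :=
          abs_integral_le_integral_abs
      _ ≤ ∫ ω, 3 * ((hawkinsY (α ω) m)⁻¹ / ((m : ℝ) - 1)) * twinTerm (α ω) m ∂μ := by
          refine h.integral_mono
            (F := fun A => |(sieveDev A (m + 3) - sieveDev A m) * twinTerm A m|)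
            (G := fun A => 3 * ((hawkinsY A m)⁻¹ / ((m : ℝ) - 1)) * twinTerm A m)
            (((hL3.sub hL).mul hX).comp abs)
            (((hY.comp fun y => 3 * (y⁻¹ / ((m : ℝ) - 1))).mono (by omega)).mul hX)
            fun A hA => ?_
          rw [abs_mul, abs_of_nonneg (twinTerm_nonneg hA hm)]
          exact mul_le_mul_of_nonneg_right (abs_sieveDev_add_three_sub_le hA hm)
            (twinTerm_nonneg hA hm)
      _ = (1 - 1 / (m : ℝ)) *
            ∫ ω, 3 * ((hawkinsY (α ω) m)⁻¹ / ((m : ℝ) - 1)) * hawkinsY (α ω) m ∂μ :=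
          h.integral_mul_twinTerm hm (W := fun A => 3 * ((hawkinsY A m)⁻¹ / ((m : ℝ) - 1)))
            (hY.comp fun y => 3 * (y⁻¹ / ((m : ℝ) - 1)))
      _ = (1 - 1 / (m : ℝ)) * ∫ ω, 3 / ((m : ℝ) - 1) ∂μ := by
          congr 1
          refine h.integral_congr
            (F := fun A => 3 * ((hawkinsY A m)⁻¹ / ((m : ℝ) - 1)) * hawkinsY A m)
            (G := fun _ => 3 / ((m : ℝ) - 1)) fun A hA => ?_
          have := hawkinsY_pos hA m
          field_simp
      _ ≤ 1 * (3 / ((m : ℝ) - 1)) := by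
          rw [integral_const, probReal_univ, one_smul]
          gcongr
      _ = _ := one_mul _
  have b1' : 3 / ((m : ℝ) - 1) ≤ 9 / Mharm m ^ 2 := by
    rw [div_le_div_iff₀ hk0 (by positivity)]
    linarith
  have b2 : |∫ ω, sieveDev (α ω) m * twinTerm (α ω) m ∂μ|
      ≤ 2 * Real.exp (4 * 22) / Mharm m ^ 2 := by
    have e2 : ∫ ω, sieveDev (α ω) m * hawkinsY (α ω) m ∂μ
        = -(Mharm m * (∫ ω, hawkinsY (α ω) m ∂μ - 1 / Mharm m)) := by
      rw [h.integral_congr (F := fun A => sieveDev A m * hawkinsY A m)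
        (G := fun A => 1 - Mharm m * hawkinsY A m)
        fun A hA => by linarith [hawkinsY_mul_Mharm hA m],
        h.integral_sub (F := fun _ => 1) (G := fun A => Mharm m * hawkinsY A m) (.const m _)
          (hY.comp (Mharm m * ·)), integral_const_mul]
      simp only [integral_const, probReal_univ, one_smul]
      field_simp
      ring
    rw [h.integral_mul_twinTerm hm (.sieveDev m), e2, abs_mul, abs_neg, abs_mul,
      abs_of_nonneg hq0, abs_of_pos (by linarith : 0 < Mharm m)]
    calc _ ≤ 1 * (Mharm m * (2 * Real.exp (4 * 22) / Mharm m ^ 3)) := by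
          gcongr
          exact h.abs_integral_hawkinsY_sub_le hm
      _ = _ := by field_simp
  rw [e1]
  calc _ ≤ 9 / Mharm m ^ 2 + 2 * Real.exp (4 * 22) / Mharm m ^ 2 :=
        (abs_add_le _ _).trans (add_le_add (b1.trans b1') b2)
    _ = _ := by ring

lemma integral_sieveDev_sq_mul_hawkinsY_mul_twinTerm_le (h : IsHawkinsSieve μ α) (hm : 2 ≤ m)
    (hmn : m + 3 ≤ n) :
    ∫ ω, sieveDev (α ω) n ^ 2 * hawkinsY (α ω) n * twinTerm (α ω) m ∂μ
      ≤ 152 * Real.exp (4 * 2) * Real.exp (4 * 22) / Mharm m ^ 2 := by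
  have hX := (DependsBelow.twinTerm m).mono hmn
  have hI : DependsBelow (m + 1) fun A => sieveInd A m := .sieveInd (by omega)
  have hII : DependsBelow (m + 3) fun A => sieveInd A m * sieveInd A (m + 2) :=
    (hI.mono (by omega)).mul (.sieveInd (by omega))
  have hII0 : ∀ A, 0 ≤ sieveInd A m * sieveInd A (m + 2) := fun A =>
    mul_nonneg (sieveInd_nonneg _ _) (sieveInd_nonneg _ _)
  have hQ : ∀ j, DependsBelow j fun A => 1 + sieveDev A j ^ 2 := fun j =>
    (DependsBelow.sieveDev j).comp fun l => 1 + l ^ 2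
  have hYn := DependsBelow.hawkinsY n
  calc _ ≤ ∫ ω, 2 * ((sieveInd (α ω) m * sieveInd (α ω) (m + 2)) * (1 + sieveDev (α ω) n ^ 2)) ∂μ := by
        refine h.integral_mono
          (F := fun A => sieveDev A n ^ 2 * hawkinsY A n * twinTerm A m)
          (G := fun A => 2 * ((sieveInd A m * sieveInd A (m + 2)) * (1 + sieveDev A n ^ 2)))
          ((((DependsBelow.sieveDev n).comp (· ^ 2)).mul hYn).mul hX)
          ((DependsBelow.const n 2).mul ((hII.mono hmn).mul (hQ n))) fun A hA => ?_
        have h1 : hawkinsY A n * twinTerm A m ≤ 2 * (sieveInd A m * sieveInd A (m + 2)) :=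
          (mul_le_mul_of_nonneg_right (hawkinsY_antitone hA (by omega))
            (twinTerm_nonneg hA hm)).trans (hawkinsY_mul_twinTerm_le hA hm)
        nlinarith [mul_le_mul_of_nonneg_left h1 (sq_nonneg (sieveDev A n)), hII0 A]
    _ = 2 * ∫ ω, (sieveInd (α ω) m * sieveInd (α ω) (m + 2)) * (1 + sieveDev (α ω) n ^ 2) ∂μ :=
        integral_const_mul _ _
    _ ≤ 2 * (Real.exp (4 * 2) * ∫ ω, (sieveInd (α ω) m * sieveInd (α ω) (m + 2))
          * (1 + sieveDev (α ω) (m + 3) ^ 2) ∂μ) := by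
        gcongr
        exact h.integral_mul_one_add_sieveDev_sq_le (by omega) hII (fun A _ => hII0 A) hmn
    _ ≤ 2 * (Real.exp (4 * 2) * ∫ ω, 19 * (((1 + sieveDev (α ω) m ^ 2) * sieveInd (α ω) m)
          * sieveInd (α ω) (m + 2)) ∂μ) := by
        gcongr 2 * (_ * ?_)
        refine h.integral_mono
          (F := fun A => (sieveInd A m * sieveInd A (m + 2)) * (1 + sieveDev A (m + 3) ^ 2))
          (G := fun A => 19 * (((1 + sieveDev A m ^ 2) * sieveInd A m) * sieveInd A (m + 2)))
          (hII.mul (hQ _)) (n := m + 3) ((DependsBelow.const _ 19).mul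
            ((((hQ m).mono (by omega)).mul (hI.mono (by omega))).mul (.sieveInd (by omega))))
          fun A hA => ?_
        nlinarith [mul_le_mul_of_nonneg_left (sieveDev_add_three_sq_le hA hm) (hII0 A)]
    _ = 38 * Real.exp (4 * 2) * ∫ ω, ((1 + sieveDev (α ω) m ^ 2) * sieveInd (α ω) m)
          * hawkinsY (α ω) (m + 2) ∂μ := by
        rw [integral_const_mul, h.integral_mul_sieveInd (m := m + 2)
          (W := fun A => (1 + sieveDev A m ^ 2) * sieveInd A m) (by omega)
          (((hQ m).mono (by omega)).mul (hI.mono (by omega)))]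
        ring
    _ ≤ 38 * Real.exp (4 * 2) * ∫ ω, ((1 + sieveDev (α ω) m ^ 2) * hawkinsY (α ω) m)
          * sieveInd (α ω) m ∂μ := by
        gcongr 38 * _ * ?_
        refine h.integral_mono (m := m + 2) (n := m + 1)
          (F := fun A => ((1 + sieveDev A m ^ 2) * sieveInd A m) * hawkinsY A (m + 2))
          (G := fun A => ((1 + sieveDev A m ^ 2) * hawkinsY A m) * sieveInd A m)
          ((((hQ m).mono (by omega)).mul (hI.mono (by omega))).mul (.hawkinsY _))
          ((((hQ m).mul (.hawkinsY m)).mono (by omega)).mul hI) fun A hA => ?_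
        have h1 : hawkinsY A (m + 2) ≤ hawkinsY A m := hawkinsY_antitone hA (by omega)
        have h2 : 0 ≤ (1 + sieveDev A m ^ 2) * sieveInd A m :=
          mul_nonneg (by positivity) (sieveInd_nonneg _ _)
        nlinarith [mul_le_mul_of_nonneg_left h1 h2]
    _ = 38 * Real.exp (4 * 2) *
          ∫ ω, hawkinsY (α ω) m ^ 2 * (1 + sieveDev (α ω) m ^ 2) ∂μ := by
        rw [h.integral_mul_sieveInd (W := fun A => (1 + sieveDev A m ^ 2) * hawkinsY A m) hm
          ((hQ m).mul (.hawkinsY m))]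
        congr 2
        ext ω
        ring
    _ ≤ 38 * Real.exp (4 * 2) * (4 * Real.exp (4 * 22) / Mharm m ^ 2) := by
        gcongr
        exact h.integral_hawkinsY_sq_mul_le hm
    _ = _ := by ring

lemma abs_integral_sum_twinTerm_sub_le (h : IsHawkinsSieve μ α) (hn : 5 ≤ n) :
    |∫ ω, ∑ m ∈ Finset.Icc 2 (n - 3), twinTerm (α ω) m ∂μ
        - (((n : ℝ) - 1) / Mharm n + ((n : ℝ) - 1) / Mharm n ^ 2)|
      ≤ (864 * (2 * Real.exp (4 * 22) + 3) + 8 * 864) * (n / Mharm n ^ 3) + 3 := by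
  have := h.isProb
  have hn2 : 2 ≤ n := by omega
  have hsub : Finset.Icc 2 (n - 3) ⊆ Finset.Icc 2 n := Finset.Icc_subset_Icc_right (by omega)
  have hterm : ∀ m, 2 ≤ m → |∫ ω, twinTerm (α ω) m ∂μ - 1 / Mharm m|
      ≤ (2 * Real.exp (4 * 22) + 3) * (1 / Mharm m ^ 3) := by
    intro m hm
    have hk := one_le_cast_sub_one hm
    have hM := one_le_Mharm m
    have hM2 := Mharm_sq_le hm
    have hm0 : (0 : ℝ) < m := by linarith
    have hq0 : 0 ≤ 1 - 1 / (m : ℝ) := by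
      rw [sub_nonneg, div_le_one (by linarith)]; linarith
    have hq1 : 1 - 1 / (m : ℝ) ≤ 1 := by
      have : 0 ≤ 1 / (m : ℝ) := by positivity
      linarith
    have e : ∫ ω, twinTerm (α ω) m ∂μ = (1 - 1 / (m : ℝ)) * ∫ ω, hawkinsY (α ω) m ∂μ := by
      simpa using h.integral_mul_twinTerm hm (W := fun _ => 1) (.const _ _)
    have e' : (1 - 1 / (m : ℝ)) * ∫ ω, hawkinsY (α ω) m ∂μ - 1 / Mharm m
        = (1 - 1 / (m : ℝ)) * (∫ ω, hawkinsY (α ω) m ∂μ - 1 / Mharm m)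
          - 1 / (m : ℝ) * (1 / Mharm m) := by ring
    rw [e, e']
    calc _ ≤ |(1 - 1 / (m : ℝ)) * (∫ ω, hawkinsY (α ω) m ∂μ - 1 / Mharm m)|
          + |1 / (m : ℝ) * (1 / Mharm m)| := abs_sub _ _
      _ ≤ 1 * (2 * Real.exp (4 * 22) / Mharm m ^ 3) + 3 / Mharm m ^ 2 * (1 / Mharm m) := by
          rw [abs_mul (1 - 1 / (m : ℝ)), abs_of_nonneg hq0,
            abs_of_nonneg (by positivity : 0 ≤ 1 / (m : ℝ) * (1 / Mharm m))]
          have h1 := h.abs_integral_hawkinsY_sub_le hm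
          have h2 : 1 / (m : ℝ) ≤ 3 / Mharm m ^ 2 := by
            rw [div_le_div_iff₀ hm0 (by positivity)]
            linarith
          gcongr
      _ = _ := by field_simp
  have e1 : ∫ ω, ∑ m ∈ Finset.Icc 2 (n - 3), twinTerm (α ω) m ∂μ
      = ∑ m ∈ Finset.Icc 2 (n - 3), ∫ ω, twinTerm (α ω) m ∂μ :=
    integral_finsetSum _ fun m _ => h.integrable (.twinTerm m)
  have b1 : |∑ m ∈ Finset.Icc 2 (n - 3), ∫ ω, twinTerm (α ω) m ∂μ
      - ∑ m ∈ Finset.Icc 2 (n - 3), 1 / Mharm m|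
      ≤ (2 * Real.exp (4 * 22) + 3) * (864 * (n / Mharm n ^ 3)) := by
    rw [← Finset.sum_sub_distrib]
    calc _ ≤ ∑ m ∈ Finset.Icc 2 (n - 3), (2 * Real.exp (4 * 22) + 3) * (1 / Mharm m ^ 3) :=
          (Finset.abs_sum_le_sum_abs _ _).trans
            (Finset.sum_le_sum fun m hm => hterm m (Finset.mem_Icc.mp hm).1)
      _ ≤ ∑ m ∈ Finset.Icc 2 n, (2 * Real.exp (4 * 22) + 3) * (1 / Mharm m ^ 3) :=
          Finset.sum_le_sum_of_subset_of_nonneg hsub fun m _ _ => by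
            have := one_le_Mharm m
            positivity
      _ ≤ _ := by
          rw [← Finset.mul_sum]
          gcongr
          exact sum_inv_Mharm_cube_le hn2
  have b2 : |∑ m ∈ Finset.Icc 2 (n - 3), 1 / Mharm m - ∑ m ∈ Finset.Icc 2 n, 1 / Mharm m|
      ≤ 3 := by
    obtain ⟨k, rfl⟩ := Nat.exists_eq_add_of_le' (show 3 ≤ n by omega)
    rw [Finset.sum_Icc_succ_top (by omega), Finset.sum_Icc_succ_top (by omega),
      Finset.sum_Icc_succ_top (by omega), Nat.add_sub_cancel]
    have hb : ∀ j, 0 ≤ 1 / Mharm j ∧ 1 / Mharm j ≤ 1 := fun j => by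
      have := one_le_Mharm j
      exact ⟨by positivity, (div_le_one (by linarith)).mpr this⟩
    have h1 := hb (k + 1)
    have h2 := hb (k + 1 + 1)
    have h3 := hb (k + 2 + 1)
    rw [abs_le]
    constructor <;> linarith [h1.1, h1.2, h2.1, h2.2, h3.1, h3.2]
  have b3 := (abs_sum_inv_Mharm_sub_le hn2).trans
    (mul_le_mul_of_nonneg_left (sum_inv_Mharm_cube_le hn2) (by norm_num))
  rw [e1]
  rw [abs_le] at b1 b2 b3 ⊢
  constructor <;> linarith [b1.1, b1.2, b2.1, b2.2, b3.1, b3.2]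

lemma abs_integral_sieveDev_mul_sum_twinTerm_le (h : IsHawkinsSieve μ α) (hn : 5 ≤ n) :
    |∫ ω, sieveDev (α ω) n * ∑ m ∈ Finset.Icc 2 (n - 3), twinTerm (α ω) m ∂μ|
      ≤ 864 * (2 * Real.exp (4 * 22) + 9) * (n / Mharm n ^ 2) := by
  have hle : ∀ m ∈ Finset.Icc 2 (n - 3), 2 ≤ m ∧ m + 3 ≤ n := fun m hm => by
    rw [Finset.mem_Icc] at hm
    omega
  simp_rw [Finset.mul_sum]
  rw [integral_finsetSum _ fun m hm =>
    h.integrable ((DependsBelow.sieveDev n).mul ((DependsBelow.twinTerm m).mono (hle m hm).2))]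
  calc _ ≤ ∑ m ∈ Finset.Icc 2 (n - 3), (2 * Real.exp (4 * 22) + 9) * (1 / Mharm m ^ 2) :=
        (Finset.abs_sum_le_sum_abs _ _).trans (Finset.sum_le_sum fun m hm => by
          rw [mul_one_div]
          exact h.abs_integral_sieveDev_mul_twinTerm_le (hle m hm).1 (hle m hm).2)
    _ ≤ ∑ m ∈ Finset.Icc 2 n, (2 * Real.exp (4 * 22) + 9) * (1 / Mharm m ^ 2) :=
        Finset.sum_le_sum_of_subset_of_nonneg (Finset.Icc_subset_Icc_right (by omega))
          fun m _ _ => by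
            have := one_le_Mharm m
            positivity
    _ ≤ (2 * Real.exp (4 * 22) + 9) * (864 * (n / Mharm n ^ 2)) := by
        rw [← Finset.mul_sum]
        gcongr
        exact sum_inv_Mharm_sq_le (by omega)
    _ = _ := by ring

lemma abs_integral_sieveDev_sq_mul_hawkinsY_mul_sum_twinTerm_le (h : IsHawkinsSieve μ α)
    (hn : 5 ≤ n) :
    |∫ ω, sieveDev (α ω) n ^ 2 * hawkinsY (α ω) n
        * ∑ m ∈ Finset.Icc 2 (n - 3), twinTerm (α ω) m ∂μ|
      ≤ 864 * (152 * Real.exp (4 * 2) * Real.exp (4 * 22)) * (n / Mharm n ^ 2) := by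
  have hle : ∀ m ∈ Finset.Icc 2 (n - 3), 2 ≤ m ∧ m + 3 ≤ n := fun m hm => by
    rw [Finset.mem_Icc] at hm
    omega
  rw [abs_of_nonneg (h.integral_nonneg (F := fun A => sieveDev A n ^ 2 * hawkinsY A n
    * ∑ m ∈ Finset.Icc 2 (n - 3), twinTerm A m) fun A hA =>
      mul_nonneg (mul_nonneg (sq_nonneg _) (hawkinsY_pos hA n).le)
        (Finset.sum_nonneg fun m hm => twinTerm_nonneg hA (hle m hm).1))]
  simp_rw [Finset.mul_sum]
  rw [integral_finsetSum _ fun m hm => h.integrable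
    ((((DependsBelow.sieveDev n).comp (· ^ 2)).mul (.hawkinsY n)).mul
      ((DependsBelow.twinTerm m).mono (hle m hm).2))]
  calc _ ≤ ∑ m ∈ Finset.Icc 2 (n - 3),
          (152 * Real.exp (4 * 2) * Real.exp (4 * 22)) * (1 / Mharm m ^ 2) :=
        Finset.sum_le_sum fun m hm => by
          rw [mul_one_div]
          exact h.integral_sieveDev_sq_mul_hawkinsY_mul_twinTerm_le (hle m hm).1 (hle m hm).2
    _ ≤ ∑ m ∈ Finset.Icc 2 n,
          (152 * Real.exp (4 * 2) * Real.exp (4 * 22)) * (1 / Mharm m ^ 2) :=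
        Finset.sum_le_sum_of_subset_of_nonneg (Finset.Icc_subset_Icc_right (by omega))
          fun m _ _ => by
            have := one_le_Mharm m
            positivity
    _ ≤ (152 * Real.exp (4 * 2) * Real.exp (4 * 22)) * (864 * (n / Mharm n ^ 2)) := by
        rw [← Finset.mul_sum]
        gcongr
        exact sum_inv_Mharm_sq_le (by omega)
    _ = _ := by ring

lemma abs_integral_hawkinsY_mul_piHat_sub_le (h : IsHawkinsSieve μ α) (hn : 5 ≤ n) :
    |∫ ω, hawkinsY (α ω) (n + 1) * piHat (α ω) n ∂μ
        - ∫ ω, hawkinsY (α ω) n * ∑ m ∈ Finset.Icc 2 (n - 3), twinTerm (α ω) m ∂μ| ≤ 8 := by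
  have := h.isProb
  have hS : DependsBelow n fun A => ∑ m ∈ Finset.Icc 2 (n - 3), twinTerm A m :=
    DependsBelow.sum fun m hm => (DependsBelow.twinTerm m).mono (by
      rw [Finset.mem_Icc] at hm
      omega)
  have hP : DependsBelow (n + 3) fun A => ∑ m ∈ Finset.Icc 2 n, twinTerm A m :=
    DependsBelow.sum fun m hm => (DependsBelow.twinTerm m).mono (by
      rw [Finset.mem_Icc] at hm
      omega)
  have hF : DependsBelow (n + 3) fun A =>
      hawkinsY A (n + 1) * ∑ m ∈ Finset.Icc 2 n, twinTerm A m :=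
    ((DependsBelow.hawkinsY (n + 1)).mono (by omega)).mul hP
  have hG : DependsBelow n fun A =>
      hawkinsY A n * ∑ m ∈ Finset.Icc 2 (n - 3), twinTerm A m :=
    (DependsBelow.hawkinsY n).mul hS
  rw [h.integral_congr (F := fun A => hawkinsY A (n + 1) * piHat A n)
    (G := fun A => hawkinsY A (n + 1) * ∑ m ∈ Finset.Icc 2 n, twinTerm A m)
    (fun A hA => by rw [piHat_eq_sum_twinTerm hA]), ← h.integral_sub hF hG]
  calc _ ≤ ∫ ω, |hawkinsY (α ω) (n + 1) * ∑ m ∈ Finset.Icc 2 n, twinTerm (α ω) m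
          - hawkinsY (α ω) n * ∑ m ∈ Finset.Icc 2 (n - 3), twinTerm (α ω) m| ∂μ :=
        abs_integral_le_integral_abs
    _ ≤ ∫ ω, (8 : ℝ) ∂μ := by
        refine h.integral_mono (m := n + 3) (n := n)
          (F := fun A => |hawkinsY A (n + 1) * ∑ m ∈ Finset.Icc 2 n, twinTerm A m
            - hawkinsY A n * ∑ m ∈ Finset.Icc 2 (n - 3), twinTerm A m|) (G := fun _ => 8)
          ((hF.sub (hG.mono (by omega))).comp abs) (.const _ _) fun A hA => ?_
        have := abs_hawkinsY_mul_piHat_sub_le hA hn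
        rwa [piHat_eq_sum_twinTerm hA] at this
    _ = 8 := by simp

lemma integral_hawkinsY_mul_eq (h : IsHawkinsSieve μ α) (hW : DependsBelow n W) :
    ∫ ω, hawkinsY (α ω) n * W (α ω) ∂μ
      = (∫ ω, W (α ω) ∂μ) / Mharm n - (∫ ω, sieveDev (α ω) n * W (α ω) ∂μ) / Mharm n ^ 2
        + (∫ ω, sieveDev (α ω) n ^ 2 * hawkinsY (α ω) n * W (α ω) ∂μ) / Mharm n ^ 2 := by
  have hL := DependsBelow.sieveDev n
  have h1 : DependsBelow n fun A => W A / Mharm n := hW.comp (· / Mharm n)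
  have h2 : DependsBelow n fun A => sieveDev A n * W A / Mharm n ^ 2 :=
    (hL.mul hW).comp (· / Mharm n ^ 2)
  have h3 : DependsBelow n fun A => sieveDev A n ^ 2 * hawkinsY A n * W A / Mharm n ^ 2 :=
    (((hL.comp (· ^ 2)).mul (.hawkinsY n)).mul hW).comp (· / Mharm n ^ 2)
  rw [← integral_div, ← integral_div, ← integral_div, ← h.integral_sub h1 h2,
    ← h.integral_add (h1.sub h2) h3]
  refine h.integral_congr (F := fun A => hawkinsY A n * W A)
    (G := fun A => W A / Mharm n - sieveDev A n * W A / Mharm n ^ 2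
      + sieveDev A n ^ 2 * hawkinsY A n * W A / Mharm n ^ 2) fun A hA => ?_
  linear_combination W A * hawkinsY_expansion hA n

end IsHawkinsSieve

theorem piHat_weighted_first_moment {Ω : Type*} [MeasurableSpace Ω] (μ : Measure Ω)
    (α : Ω → Set ℕ) (h : IsHawkinsSieve μ α) :
    (fun n : ℕ =>
        (∫ ω, hawkinsY (α ω) (n + 1) * piHat (α ω) n ∂μ) -
          ((n : ℝ) / (Mharm n) ^ 2 + (n : ℝ) / (Mharm n) ^ 3))
      =O[atTop] fun n : ℕ => (n : ℝ) / (Mharm n) ^ 4 := by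
  obtain ⟨C₁, hC₁⟩ : ∃ C : ℝ, C = 864 * (2 * Real.exp (4 * 22) + 3) + 8 * 864 := ⟨_, rfl⟩
  obtain ⟨C₂, hC₂⟩ : ∃ C : ℝ, C = 864 * (2 * Real.exp (4 * 22) + 9) := ⟨_, rfl⟩
  obtain ⟨C₃, hC₃⟩ : ∃ C : ℝ, C = 864 * (152 * Real.exp (4 * 2) * Real.exp (4 * 22)) := ⟨_, rfl⟩
  refine IsBigO.of_bound (C₁ + C₂ + C₃ + 13 * 1296) ?_
  filter_upwards [eventually_ge_atTop 5] with n hn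
  have hM := one_le_Mharm n
  have hM0 : 0 < Mharm n := by linarith
  have hone : 1 ≤ 1296 * ((n : ℝ) / Mharm n ^ 4) := by
    rw [← mul_div_assoc, one_le_div (by positivity)]
    have h1 : Mharm n ^ 4 ≤ (Mharm n + 5) ^ 4 := by gcongr; linarith
    linarith [Mharm_add_five_pow_four_le (show 2 ≤ n by omega)]
  have hS : DependsBelow n fun A => ∑ m ∈ Finset.Icc 2 (n - 3), twinTerm A m :=
    DependsBelow.sum fun m hm => (DependsBelow.twinTerm m).mono (by
      rw [Finset.mem_Icc] at hm
      omega)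
  have b0 := h.abs_integral_hawkinsY_mul_piHat_sub_le hn
  have b1 := h.abs_integral_sum_twinTerm_sub_le hn
  have b2 := h.abs_integral_sieveDev_mul_sum_twinTerm_le hn
  have b3 := h.abs_integral_sieveDev_sq_mul_hawkinsY_mul_sum_twinTerm_le hn
  rw [h.integral_hawkinsY_mul_eq hS] at b0
  rw [← hC₁] at b1
  rw [← hC₂] at b2
  rw [← hC₃] at b3
  set T := ∫ ω, hawkinsY (α ω) (n + 1) * piHat (α ω) n ∂μ
  set E₁ := ∫ ω, ∑ m ∈ Finset.Icc 2 (n - 3), twinTerm (α ω) m ∂μ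
  set E₂ := ∫ ω, sieveDev (α ω) n * ∑ m ∈ Finset.Icc 2 (n - 3), twinTerm (α ω) m ∂μ
  set E₃ := ∫ ω, sieveDev (α ω) n ^ 2 * hawkinsY (α ω) n
    * ∑ m ∈ Finset.Icc 2 (n - 3), twinTerm (α ω) m ∂μ
  generalize Mharm n = M at *
  have hn0 : (0 : ℝ) ≤ n := Nat.cast_nonneg n
  have c1 : |(E₁ - (((n : ℝ) - 1) / M + ((n : ℝ) - 1) / M ^ 2)) / M|
      ≤ C₁ * (n / M ^ 4) + 3 := by
    rw [abs_div, abs_of_pos hM0, div_le_iff₀ hM0]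
    have : C₁ * (n / M ^ 3) = C₁ * (n / M ^ 4) * M := by field_simp
    linarith
  have c2 : |E₂ / M ^ 2| ≤ C₂ * (n / M ^ 4) := by
    rw [abs_div, abs_of_pos (by positivity : 0 < M ^ 2), div_le_iff₀ (by positivity)]
    refine b2.trans_eq ?_
    field_simp
  have c3 : |E₃ / M ^ 2| ≤ C₃ * (n / M ^ 4) := by
    rw [abs_div, abs_of_pos (by positivity : 0 < M ^ 2), div_le_iff₀ (by positivity)]
    refine b3.trans_eq ?_
    field_simp
  have c4 : |1 / M ^ 2 + 1 / M ^ 3| ≤ 2 := by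
    have i2 : 1 / M ^ 2 ≤ 1 := (div_le_one (by positivity)).mpr (one_le_pow₀ hM)
    have i3 : 1 / M ^ 3 ≤ 1 := (div_le_one (by positivity)).mpr (one_le_pow₀ hM)
    rw [abs_of_pos (by positivity)]
    linarith
  have e : T - ((n : ℝ) / M ^ 2 + (n : ℝ) / M ^ 3)
      = (T - (E₁ / M - E₂ / M ^ 2 + E₃ / M ^ 2))
        + (E₁ - (((n : ℝ) - 1) / M + ((n : ℝ) - 1) / M ^ 2)) / M
        - E₂ / M ^ 2 + E₃ / M ^ 2 - (1 / M ^ 2 + 1 / M ^ 3) := by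
    field_simp
    ring
  rw [Real.norm_eq_abs, Real.norm_of_nonneg (by positivity), e]
  rw [abs_le] at b0 c1 c2 c3 c4 ⊢
  constructor <;> linarith [b0.1, b0.2, c1.1, c1.2, c2.1, c2.2, c3.1, c3.2, c4.1, c4.2]
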